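/- The following asymptotics hold as n → ∞ along n ∈ I (i.e. there are positive constants and a threshold beyond which the stated two-sided or one-sided bounds hold): (i) if E[ξ³] < ∞ then E_{τ_n}[N_2] = Θ(√n) and E_{τ_n}[√(N_2)] = Θ(log n); (ii) if E[ξ^{7/2}] < ∞ then E_{τ_n}[N_{2+}] = Θ(√n); (iii) if E[ξ⁴] < ∞ then E_{τ_n}[N_3] = O(log n); (iv) if E[ξ⁵] < ∞ then E_{τ_n}[N_{3+}] = O(log n) and E_{τ_n}[N_4] = O(1); (v) if E[ξ^{13/2}] < ∞ then E_{τ_n}[N_{4+}] = O(1). Moreover, if Σ_{ℓ ≥ 3} p_ℓ > 0, then in (iii) the bound O(log n) can be improved to Θ(log n). -/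

import Mathlib

/-! Finite ordered rooted (plane) trees: a tree is a finite list of its root subtrees. -/
inductive PTree : Type where
  | node : List PTree → PTree

namespace PTree

/-- the number of nodes of the tree -/
def size : PTree → ℕ
  | node ts => 1 + (ts.attach.map (fun x => size x.1)).sum
decreasing_by
  have := List.sizeOf_lt_of_mem x.2
  simp only [node.sizeOf_spec]; omega

/-- the list of all subtrees rooted at the nodes of the tree -/
def subtrees : PTree → List PTree
  | node ts => node ts :: (ts.attach.map (fun x => subtrees x.1)).flatten
decreasing_by
  have := List.sizeOf_lt_of_mem x.2
  simp only [node.sizeOf_spec]; omega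

/-- the height of the tree (maximal distance from the root to a node) -/
def height : PTree → ℕ
  | node ts => (ts.attach.map (fun x => height x.1 + 1)).foldr max 0
decreasing_by
  have := List.sizeOf_lt_of_mem x.2
  simp only [node.sizeOf_spec]; omega

/-- the number of children of the root (`ξ_ε`) -/
def rootDeg : PTree → ℕ
  | node ts => ts.length

/-- the sizes of the subtrees rooted at the children of the root -/
def childSizes : PTree → List ℕ
  | node ts => ts.map size

/-- the sizes of the subtrees rooted at the children of the root,
sorted from largest to smallest -/
def sortedSizesDesc (T : PTree) : List ℕ :=
  T.childSizes.insertionSort (· ≥ ·)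

/-- `N_k`: the `k`-th largest among the sizes of the subtrees rooted at the children
of the root (`0` if there are fewer than `k` children) -/
def Nk (k : ℕ) (T : PTree) : ℕ := (sortedSizesDesc T).getD (k - 1) 0

/-- `N_{k+} = N_k + N_{k+1} + ⋯` -/
def NkPlus (k : ℕ) (T : PTree) : ℕ := ((sortedSizesDesc T).drop (k - 1)).sum

/-- the subtrees rooted at the nodes of the heavy path: starting at the root, always
continue to the first child of maximal subtree size -/
def heavyPath : PTree → List PTree
  | node ts =>
    node ts ::
      (match ts.attach.find? (fun x => x.1.size = ((ts.map size).foldr max 0)) with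
       | some x => heavyPath x.1
       | none => [])
decreasing_by
  have := List.sizeOf_lt_of_mem x.2
  simp only [node.sizeOf_spec]; omega

end PTree

/-- `Z_k`: the number of nodes `v` of the tree whose subtree has size `k` -/
def Zk (k : ℕ) (T : PTree) : ℕ := (T.subtrees.filter (fun s => s.size = k)).length

/-- the rank (`1` = largest) of the `i`-th child (0-based) among siblings whose subtree
sizes are given by the list `sizes`; ties are broken from left to right -/
def rankIn (sizes : List ℕ) (i : ℕ) : ℕ :=
  1 + ((List.range sizes.length).filter (fun j =>
        sizes.getD i 0 < sizes.getD j 0 ∨ (sizes.getD j 0 = sizes.getD i 0 ∧ j < i))).length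

mutual
/-- the number of nodes of the `k`-heavy tree: the root together with all nodes `v` such
that `v` and every non-root ancestor of `v` has rank at most `k` among its siblings -/
def heavySize (k : ℕ) : PTree → ℕ
  | .node ts => 1 + heavySizeAux k (ts.map PTree.size) 0 ts
def heavySizeAux (k : ℕ) (sizes : List ℕ) : ℕ → List PTree → ℕ
  | _, [] => 0
  | i, t :: rest =>
      (if rankIn sizes i ≤ k then heavySize k t else 0) + heavySizeAux k sizes (i + 1) rest
end

/-- `H*(v,ℓ)`: the height of the subtree rooted at the child of rank `ℓ` of the root of `v`
(`0` if there are fewer than `ℓ` children) -/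
def Hstar : PTree → ℕ → ℕ
  | .node ts, ℓ =>
    match (List.range ts.length).find? (fun i => rankIn (ts.map PTree.size) i = ℓ) with
    | some i => (ts.getD i (.node [])).height
    | none => 0

/-- the weight of a tree: the product over all nodes `v` of `p (number of children of v)` -/
noncomputable def weight (p : ℕ → ℝ) : PTree → ℝ
  | .node ts => p ts.length * (ts.attach.map (fun x => weight p x.1)).prod
decreasing_by
  have := List.sizeOf_lt_of_mem x.2
  simp only [PTree.node.sizeOf_spec]; omega

/-- the total weight of all trees of size `n` -/
noncomputable def treeSum (p : ℕ → ℝ) (n : ℕ) : ℝ :=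
  ∑' T : {T : PTree // T.size = n}, weight p T.1

/-- the probability of the event `A` under the conditional Galton-Watson tree `τ_n` -/
noncomputable def condProb (p : ℕ → ℝ) (n : ℕ) (A : PTree → Prop) : ℝ :=
  (∑' T : {T : PTree // T.size = n ∧ A T}, weight p T.1) / treeSum p n

/-- the expectation of `f` under the conditional Galton-Watson tree `τ_n` -/
noncomputable def condExp (p : ℕ → ℝ) (n : ℕ) (f : PTree → ℝ) : ℝ :=
  (∑' T : {T : PTree // T.size = n}, weight p T.1 * f T.1) / treeSum p n

/-- the variance of `f` under the conditional Galton-Watson tree `τ_n` -/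
noncomputable def condVar (p : ℕ → ℝ) (n : ℕ) (f : PTree → ℝ) : ℝ :=
  condExp p n (fun T => f T ^ 2) - (condExp p n f) ^ 2

/-- the set `I = {n ≥ 1 : Σ_{|T| = n} w(T) > 0}` of sizes of positive probability -/
def gwSupport (p : ℕ → ℝ) : Set ℕ := {n | 1 ≤ n ∧ 0 < treeSum p n}

/-- `P(S_m = x)` for the random walk `S_m = (ξ_1 - 1) + ⋯ + (ξ_m - 1)`, `ξ_i` i.i.d. `∼ p` -/
noncomputable def walkProb (p : ℕ → ℝ) (m : ℕ) (x : ℤ) : ℝ :=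
  ∑' a : Fin m → ℕ, if (∑ i, ((a i : ℤ) - 1)) = x then ∏ i, p (a i) else 0

/-- `I_n = {1 ≤ k ≤ n : P(S_{n-k} = 0) > 0}` -/
def walkSupportIn (p : ℕ → ℝ) (n : ℕ) : Set ℕ :=
  {k | 1 ≤ k ∧ k ≤ n ∧ 0 < walkProb p (n - k) 0}

/-- `h = gcd {i > 0 : p_i > 0}`, defined as the largest common divisor of the support -/
noncomputable def gcdSupp (p : ℕ → ℝ) : ℕ :=
  sSup {d : ℕ | 0 < d ∧ ∀ i : ℕ, 0 < i → 0 < p i → d ∣ i}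

/-- `α = h / (σ √(2π))` where `σ² = Σ i² p_i - 1` -/
noncomputable def gwAlpha (p : ℕ → ℝ) : ℝ :=
  (gcdSupp p : ℝ) /
    (Real.sqrt ((∑' i : ℕ, (i : ℝ) ^ 2 * p i) - 1) * Real.sqrt (2 * Real.pi))

/-- the moment `E[ξ^m] = Σ i^m p_i` is finite -/
def MomentFinite (p : ℕ → ℝ) (m : ℝ) : Prop :=
  Summable (fun i : ℕ => (i : ℝ) ^ m * p i)

/-- A probability distribution on `ℕ` with mean one and finite positive variance. -/
structure IsCriticalLaw (p : ℕ → ℝ) : Prop where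
  nonneg : ∀ i, 0 ≤ p i
  hasSum : HasSum p 1
  hasSum_mean : HasSum (fun i : ℕ => (i : ℝ) * p i) 1
  summable_sq : Summable fun i : ℕ => (i : ℝ) ^ 2 * p i
  one_lt_sq : 1 < ∑' i : ℕ, (i : ℝ) ^ 2 * p i

/-- The mass at `m` of the sum of `n` independent variables with law `p`. -/
noncomputable def stepProb (p : ℕ → ℝ) (n m : ℕ) : ℝ :=
  PowerSeries.coeff m (PowerSeries.mk p ^ n)

/-- The characteristic function `θ ↦ ∑ p_j e^{ijθ}`. -/
noncomputable def stepChar (p : ℕ → ℝ) (θ : ℝ) : ℂ :=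
  ∑' j : ℕ, (p j : ℂ) * Complex.exp (θ * Complex.I) ^ j

lemma stepProb_succ (p : ℕ → ℝ) (n m : ℕ) :
    stepProb p (n + 1) m =
      ∑ kl ∈ Finset.HasAntidiagonal.antidiagonal m, p kl.1 * stepProb p n kl.2 := by
  simp [stepProb, pow_succ', PowerSeries.coeff_mul]

lemma stepProb_nonneg {p : ℕ → ℝ} (hp : ∀ i, 0 ≤ p i) (n m : ℕ) : 0 ≤ stepProb p n m := by
  induction n generalizing m with
  | zero => simp only [stepProb, pow_zero, PowerSeries.coeff_one]; split_ifs <;> simp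
  | succ n ih =>
    rw [stepProb_succ]
    exact Finset.sum_nonneg fun kl _ => mul_nonneg (hp _) (ih _)

lemma dvd_of_stepProb_ne_zero {p : ℕ → ℝ} {h : ℕ} (hh : ∀ j, p j ≠ 0 → h ∣ j) {n m : ℕ}
    (hm : stepProb p n m ≠ 0) : h ∣ m := by
  induction n generalizing m with
  | zero =>
    have : m = 0 := by
      by_contra hne
      simp [stepProb, PowerSeries.coeff_one, hne] at hm
    simp [this]
  | succ n ih =>
    rw [stepProb_succ] at hm
    obtain ⟨kl, hkl, hne⟩ := Finset.exists_ne_zero_of_sum_ne_zero hm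
    rw [← Finset.HasAntidiagonal.mem_antidiagonal.1 hkl]
    exact dvd_add (hh _ (left_ne_zero_of_mul hne)) (ih (right_ne_zero_of_mul hne))

lemma norm_exp_ofReal_mul_I_pow (θ : ℝ) (j : ℕ) : ‖Complex.exp (θ * Complex.I) ^ j‖ = 1 := by
  rw [norm_pow, Complex.norm_exp_ofReal_mul_I, one_pow]

lemma summable_stepProb_and_tsum_eq_pow {p : ℕ → ℝ} (hp : ∀ i, 0 ≤ p i) (hs : Summable p) (n : ℕ) :
    Summable (stepProb p n) ∧ ∀ θ : ℝ,
      ∑' m, (stepProb p n m : ℂ) * Complex.exp (θ * Complex.I) ^ m = stepChar p θ ^ n := by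
  have key : ∀ f : ℕ → ℝ, (∀ i, 0 ≤ f i) → Summable f → ∀ θ : ℝ,
      Summable fun m => ‖(f m : ℂ) * Complex.exp (θ * Complex.I) ^ m‖ := by
    intro f hf hs θ
    refine hs.congr fun m => ?_
    rw [norm_mul, norm_exp_ofReal_mul_I_pow, mul_one, Complex.norm_real, Real.norm_of_nonneg (hf m)]
  induction n with
  | zero =>
    constructor
    · refine summable_of_ne_finset_zero (s := {0}) fun b hb => ?_
      simp only [Finset.mem_singleton] at hb
      simp [stepProb, PowerSeries.coeff_one, hb]
    · intro θ
      rw [tsum_eq_single 0]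
      · simp [stepProb]
      · intro b hb
        simp [stepProb, PowerSeries.coeff_one, hb]
  | succ n ih =>
    have hnn := stepProb_nonneg hp n
    constructor
    · have := summable_norm_sum_mul_antidiagonal_of_summable_norm (f := p) (g := stepProb p n)
        (hs.congr fun i => (Real.norm_of_nonneg (hp i)).symm)
        (ih.1.congr fun i => (Real.norm_of_nonneg (hnn i)).symm)
      refine this.of_norm.congr fun m => ?_
      rw [stepProb_succ]
    · intro θ
      rw [pow_succ', ← ih.2 θ, stepChar,
        tsum_mul_tsum_eq_tsum_sum_antidiagonal_of_summable_norm (key p hp hs θ) (key _ hnn ih.1 θ)]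
      refine tsum_congr fun m => ?_
      rw [stepProb_succ, Complex.ofReal_sum, Finset.sum_mul]
      refine Finset.sum_congr rfl fun kl hkl => ?_
      rw [← Finset.HasAntidiagonal.mem_antidiagonal.1 hkl, pow_add]
      push_cast
      ring

/-- Fourier inversion for a law supported on the multiples of `h`. -/
lemma stepProb_eq_integral {p : ℕ → ℝ} (hp : ∀ i, 0 ≤ p i) (hs : Summable p) {h : ℕ} (h0 : 0 < h)
    (hh : ∀ j, p j ≠ 0 → h ∣ j) (n m : ℕ) (hm : h ∣ m) :
    (stepProb p n m : ℂ) = h / (2 * Real.pi) *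
      ∫ θ in (-(Real.pi / h))..(Real.pi / h),
        stepChar p θ ^ n * Complex.exp (-(m * θ * Complex.I)) := by
  obtain ⟨hsum, hpow⟩ := summable_stepProb_and_tsum_eq_pow hp hs n
  have hπ := Real.pi_pos
  have hh0 : (0 : ℝ) < h := by exact_mod_cast h0
  have hnn := stepProb_nonneg hp n
  have hterm : ∀ j : ℕ, ∫ θ : ℝ in (-(Real.pi / h))..(Real.pi / h),
      (stepProb p n j : ℂ) * Complex.exp (θ * Complex.I) ^ j *
        Complex.exp (-(m * θ * Complex.I)) =
          if j = m then 2 * Real.pi / h * stepProb p n m else 0 := by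
    intro j
    have h1 : ∀ θ : ℝ, (stepProb p n j : ℂ) * Complex.exp (θ * Complex.I) ^ j *
        Complex.exp (-(m * θ * Complex.I)) =
        stepProb p n j * Complex.exp (((j : ℂ) - m) * Complex.I * θ) := by
      intro θ
      rw [← Complex.exp_nat_mul, mul_assoc, ← Complex.exp_add]
      ring_nf
    simp_rw [h1]
    rw [intervalIntegral.integral_const_mul]
    split_ifs with hjm
    · subst hjm
      simp
      ring
    · by_cases hj : stepProb p n j = 0
      · simp [hj]
      obtain ⟨a, rfl⟩ := dvd_of_stepProb_ne_zero hh hj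
      obtain ⟨b, rfl⟩ := hm
      have hne : ((((h * a : ℕ) : ℂ) - ((h * b : ℕ) : ℂ)) * Complex.I) ≠ 0 := by
        refine mul_ne_zero (sub_ne_zero.2 ?_) Complex.I_ne_zero
        exact_mod_cast hjm
      have hhc : (h : ℂ) ≠ 0 := by exact_mod_cast h0.ne'
      rw [integral_exp_mul_complex hne]
      have : Complex.exp ((((h * a : ℕ) : ℂ) - ((h * b : ℕ) : ℂ)) * Complex.I *
            ((Real.pi / h : ℝ) : ℂ)) =
          Complex.exp ((((h * a : ℕ) : ℂ) - ((h * b : ℕ) : ℂ)) * Complex.I *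
            ((-(Real.pi / h) : ℝ) : ℂ)) := by
        rw [Complex.exp_eq_exp_iff_exists_int]
        refine ⟨(a : ℤ) - b, ?_⟩
        push_cast
        field_simp
        ring
      rw [this]
      simp
  have hnorm : ∀ (j : ℕ) (θ : ℝ), ‖(stepProb p n j : ℂ) * Complex.exp (θ * Complex.I) ^ j *
        Complex.exp (-(m * θ * Complex.I))‖ = stepProb p n j := by
    intro j θ
    have : -(m * θ * Complex.I) = ((-(m * θ) : ℝ) : ℂ) * Complex.I := by push_cast; ring
    rw [this, norm_mul, norm_mul, norm_exp_ofReal_mul_I_pow, Complex.norm_exp_ofReal_mul_I,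
      Complex.norm_real, Real.norm_of_nonneg (hnn j), mul_one, mul_one]
  have hint : ∫ θ : ℝ in (-(Real.pi / h))..(Real.pi / h),
        stepChar p θ ^ n * Complex.exp (-(m * θ * Complex.I)) =
          2 * Real.pi / h * stepProb p n m := by
    have := intervalIntegral.hasSum_integral_of_dominated_convergence
      (a := -(Real.pi / h)) (b := Real.pi / h) (μ := MeasureTheory.volume)
      (F := fun (j : ℕ) (θ : ℝ) => (stepProb p n j : ℂ) * Complex.exp (θ * Complex.I) ^ j *
        Complex.exp (-(m * θ * Complex.I)))
      (f := fun θ => stepChar p θ ^ n * Complex.exp (-(m * θ * Complex.I)))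
      (bound := fun j _ => stepProb p n j)
      (fun j => Continuous.aestronglyMeasurable (by fun_prop))
      (fun j => Filter.Eventually.of_forall fun θ _ => (hnorm j θ).le)
      (Filter.Eventually.of_forall fun θ _ => hsum)
      (by simp)
      (Filter.Eventually.of_forall fun θ _ => by
        rw [← hpow θ, ← tsum_mul_right]
        exact (Summable.of_norm (hsum.congr fun j => (hnorm j θ).symm)).hasSum)
    simp_rw [hterm] at this
    rw [← this.tsum_eq, tsum_eq_single m (fun j hj => by simp [hj])]
    simp
  rw [hint]
  have : (Real.pi : ℂ) ≠ 0 := by exact_mod_cast hπ.ne'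
  have hhc : (h : ℂ) ≠ 0 := by exact_mod_cast h0.ne'
  field_simp

lemma norm_stepChar_le_one {p : ℕ → ℝ} (hp : IsCriticalLaw p) (θ : ℝ) : ‖stepChar p θ‖ ≤ 1 := by
  refine tsum_of_norm_bounded hp.hasSum fun j => ?_
  rw [norm_mul, norm_exp_ofReal_mul_I_pow, mul_one, Complex.norm_real,
    Real.norm_of_nonneg (hp.nonneg j)]

lemma IsCriticalLaw.exists_two_le {p : ℕ → ℝ} (hp : IsCriticalLaw p) : ∃ d, 2 ≤ d ∧ 0 < p d := by
  by_contra! hcon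
  have h0 : ∀ i : ℕ, (i : ℝ) ^ 2 * p i = i * p i := by
    intro i
    rcases lt_or_ge i 2 with hi | hi
    · interval_cases i <;> simp
    · rw [le_antisymm (hcon i hi) (hp.nonneg i)]; simp
  have := hp.one_lt_sq
  simp_rw [h0, hp.hasSum_mean.tsum_eq] at this
  exact lt_irrefl _ this

lemma IsCriticalLaw.zero_pos {p : ℕ → ℝ} (hp : IsCriticalLaw p) : 0 < p 0 := by
  obtain ⟨d, hd2, hd⟩ := hp.exists_two_le
  by_contra hcon
  have hp0 : p 0 = 0 := le_antisymm (not_lt.1 hcon) (hp.nonneg 0)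
  have : (1 : ℝ) < 1 := by
    refine hasSum_lt (f := p) (g := fun i : ℕ => (i : ℝ) * p i) (i := d) ?_ ?_
      hp.hasSum hp.hasSum_mean
    · intro i
      rcases Nat.eq_zero_or_pos i with rfl | hi
      · simp [hp0]
      · exact le_mul_of_one_le_left (hp.nonneg i) (Nat.one_le_cast.2 hi)
    · have : (2 : ℝ) ≤ d := by exact_mod_cast hd2
      nlinarith
  exact lt_irrefl _ this

lemma norm_add_mul_exp_le {a b : ℝ} (ha : 0 < a) (hb : 0 < b) (α : ℝ) :
    ‖(a : ℂ) + b * Complex.exp (α * Complex.I)‖ ≤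
      a + b - 2 * a * b / (a + b) * Real.sin (α / 2) ^ 2 := by
  have hsin : Real.sin (α / 2) ^ 2 ≤ 1 := Real.sin_sq_le_one _
  have hab : 0 < a + b := by positivity
  have hcos : Real.cos α = 1 - 2 * Real.sin (α / 2) ^ 2 := by
    rw [Real.sin_sq_eq_half_sub]; ring_nf
  have hre : 0 ≤ a + b - 2 * a * b / (a + b) * Real.sin (α / 2) ^ 2 := by
    have : 2 * a * b / (a + b) ≤ a + b := by rw [div_le_iff₀ hab]; nlinarith
    have h2 : 0 ≤ 2 * a * b / (a + b) := by positivity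
    nlinarith
  refine abs_le_of_sq_le_sq' ?_ hre |>.2
  have : ‖(a : ℂ) + b * Complex.exp (α * Complex.I)‖ ^ 2 =
      a ^ 2 + b ^ 2 + 2 * a * b * Real.cos α := by
    rw [Complex.sq_norm, Complex.normSq_apply, Complex.exp_mul_I]
    simp [← Complex.ofReal_cos, ← Complex.ofReal_sin]
    nlinarith [Real.sin_sq_add_cos_sq α]
  rw [this, hcos, sub_sq]
  have h3 : (a + b) * (2 * a * b / (a + b)) = 2 * a * b := by field_simp
  nlinarith [sq_nonneg (2 * a * b / (a + b) * Real.sin (α / 2) ^ 2)]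

lemma exists_sin_sq_le_one_sub_norm_stepChar {p : ℕ → ℝ} (hp : IsCriticalLaw p) {j : ℕ}
    (hj : p j ≠ 0) :
    ∃ C : ℝ, ∀ θ : ℝ, Real.sin (j * θ / 2) ^ 2 ≤ C * (1 - ‖stepChar p θ‖) := by
  rcases Nat.eq_zero_or_pos j with rfl | hj0
  · exact ⟨0, fun θ => by simp⟩
  have hp0 := hp.zero_pos
  have hpj : 0 < p j := lt_of_le_of_ne (hp.nonneg j) hj.symm
  have hne : (0 : ℕ) ≠ j := hj0.ne
  refine ⟨(p 0 + p j) / (2 * p 0 * p j), fun θ => ?_⟩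
  set z := Complex.exp (θ * Complex.I) with hz
  have hs := hp.hasSum.summable
  have hnorm : ∀ i, ‖(p i : ℂ) * z ^ i‖ = p i := fun i => by
    rw [norm_mul, norm_exp_ofReal_mul_I_pow, mul_one, Complex.norm_real,
      Real.norm_of_nonneg (hp.nonneg i)]
  have hsc : Summable fun i => (p i : ℂ) * z ^ i :=
    Summable.of_norm (hs.congr fun i => (hnorm i).symm)
  have h1 := hsc.sum_add_tsum_subtype_compl {0, j}
  have h2 := hs.sum_add_tsum_subtype_compl {0, j}
  rw [Finset.sum_pair hne] at h1 h2
  rw [hp.hasSum.tsum_eq] at h2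
  have h3 : ‖∑' i : { x // x ∉ ({0, j} : Finset ℕ) }, (p i : ℂ) * z ^ (i : ℕ)‖ ≤
      ∑' i : { x // x ∉ ({0, j} : Finset ℕ) }, p i :=
    tsum_of_norm_bounded (hs.subtype _).hasSum fun i => (hnorm i).le
  have h4 : ‖(p 0 : ℂ) * z ^ 0 + p j * z ^ j‖ ≤
      p 0 + p j - 2 * p 0 * p j / (p 0 + p j) * Real.sin (j * θ / 2) ^ 2 := by
    have := norm_add_mul_exp_le hp0 hpj (j * θ)
    rw [pow_zero, mul_one, hz, ← Complex.exp_nat_mul]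
    convert this using 5
    push_cast; ring
  have h5 : ‖stepChar p θ‖ ≤ 1 - 2 * p 0 * p j / (p 0 + p j) * Real.sin (j * θ / 2) ^ 2 := by
    rw [stepChar, ← hz, ← h1]
    refine (norm_add_le _ _).trans ?_
    linarith
  rw [div_mul_eq_mul_div, le_div_iff₀ (by positivity)]
  rw [div_mul_eq_mul_div] at h5
  have h6 : 2 * p 0 * p j * Real.sin (j * θ / 2) ^ 2 / (p 0 + p j) ≤ 1 - ‖stepChar p θ‖ := by
    linarith
  rw [div_le_iff₀ (by positivity)] at h6
  linarith

lemma abs_sin_add_le (x y : ℝ) : |Real.sin (x + y)| ≤ |Real.sin x| + |Real.sin y| := by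
  rw [Real.sin_add]
  refine (abs_add_le _ _).trans ?_
  rw [abs_mul, abs_mul]
  have h1 := Real.abs_cos_le_one x
  have h2 := Real.abs_cos_le_one y
  have h3 := abs_nonneg (Real.sin x)
  have h4 := abs_nonneg (Real.sin y)
  nlinarith

/-- The period of the law: it is supported on the multiples of `h`, and the characteristic function
decays like a Gaussian on `[-π/h, π/h]`. -/
lemma exists_period {p : ℕ → ℝ} (hp : IsCriticalLaw p) :
    ∃ h : ℕ, 0 < h ∧ (∀ j, p j ≠ 0 → h ∣ j) ∧ ∃ c : ℝ, 0 < c ∧ ∀ θ : ℝ, |θ| ≤ Real.pi / h →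
      ‖stepChar p θ‖ ≤ Real.exp (-c * θ ^ 2) := by
  let D : ℝ → ℝ := fun θ => √(1 - ‖stepChar p θ‖)
  let G : AddSubgroup ℤ :=
    { carrier := {a | ∃ C : ℝ, ∀ θ : ℝ, |Real.sin (a * θ / 2)| ≤ C * D θ}
      zero_mem' := ⟨0, fun θ => by simp⟩
      add_mem' := by
        rintro a b ⟨C, hC⟩ ⟨C', hC'⟩
        refine ⟨C + C', fun θ => ?_⟩
        have := abs_sin_add_le (a * θ / 2) (b * θ / 2)
        have h1 := hC θ
        have h2 := hC' θ
        push_cast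
        rw [show ((a : ℝ) + b) * θ / 2 = a * θ / 2 + b * θ / 2 by ring]
        linarith
      neg_mem' := by
        rintro a ⟨C, hC⟩
        refine ⟨C, fun θ => ?_⟩
        push_cast
        rw [show -(a : ℝ) * θ / 2 = -(a * θ / 2) by ring, Real.sin_neg, abs_neg]
        exact hC θ }
  have hG : ∀ j : ℕ, p j ≠ 0 → (j : ℤ) ∈ G := by
    intro j hj
    obtain ⟨C, hC⟩ := exists_sin_sq_le_one_sub_norm_stepChar hp hj
    refine ⟨√C, fun θ => ?_⟩
    have hnn : 0 ≤ 1 - ‖stepChar p θ‖ := sub_nonneg.2 (norm_stepChar_le_one hp θ)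
    rw [← Real.sqrt_sq_eq_abs, ← Real.sqrt_mul' C hnn]
    exact Real.sqrt_le_sqrt (by exact_mod_cast hC θ)
  obtain ⟨a, ha⟩ := Int.subgroup_cyclic (AddSubgroup.closure {b : ℤ | ∃ j : ℕ, p j ≠ 0 ∧ b = j})
  have haG : a ∈ G := by
    have h1 : AddSubgroup.closure {b : ℤ | ∃ j : ℕ, p j ≠ 0 ∧ b = j} ≤ G := by
      rw [AddSubgroup.closure_le]
      rintro b ⟨j, hj, rfl⟩
      exact hG j hj
    apply h1
    rw [ha]
    exact AddSubgroup.subset_closure rfl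
  have hdvd : ∀ j, p j ≠ 0 → a.natAbs ∣ j := by
    intro j hj
    have h1 : (j : ℤ) ∈ AddSubgroup.closure {b : ℤ | ∃ j : ℕ, p j ≠ 0 ∧ b = j} :=
      AddSubgroup.subset_closure ⟨j, hj, rfl⟩
    rw [ha, ← AddSubgroup.zmultiples_eq_closure, Int.mem_zmultiples_iff] at h1
    exact Int.natCast_dvd_natCast.1 (Int.natAbs_dvd.2 h1)
  have ha0 : 0 < a.natAbs := by
    obtain ⟨d, hd2, hd⟩ := hp.exists_two_le
    exact Nat.pos_of_dvd_of_pos (hdvd d hd.ne') (by omega)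
  refine ⟨a.natAbs, ha0, hdvd, ?_⟩
  have hhG : ((a.natAbs : ℕ) : ℤ) ∈ G := by
    rcases Int.natAbs_eq a with h | h
    · rwa [← h]
    · rw [← neg_neg ((a.natAbs : ℕ) : ℤ), ← h]
      exact G.neg_mem haG
  set h := a.natAbs
  obtain ⟨C, hC⟩ := hhG
  have hh0 : (0 : ℝ) < h := by exact_mod_cast ha0
  have hπ := Real.pi_pos
  refine ⟨h ^ 2 / (Real.pi ^ 2 * (C ^ 2 + 1)), by positivity, fun θ hθ => ?_⟩
  have hle : |(h : ℝ) * θ / 2| ≤ Real.pi / 2 := by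
    rw [abs_div, abs_mul, abs_of_pos hh0, abs_of_pos (two_pos : (0 : ℝ) < 2)]
    rw [le_div_iff₀ hh0] at hθ
    linarith
  have h1 := Real.mul_abs_le_abs_sin hle
  have h2 : |Real.sin ((h : ℝ) * θ / 2)| ≤ C * D θ := by exact_mod_cast hC θ
  have hnn : 0 ≤ 1 - ‖stepChar p θ‖ := sub_nonneg.2 (norm_stepChar_le_one hp θ)
  have h3 : (2 / Real.pi * |(h : ℝ) * θ / 2|) ^ 2 ≤ (C * D θ) ^ 2 :=
    pow_le_pow_left₀ (by positivity) (h1.trans h2) 2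
  rw [mul_pow, mul_pow, sq_abs, Real.sq_sqrt hnn] at h3
  have h4 : (h : ℝ) ^ 2 / Real.pi ^ 2 * θ ^ 2 ≤ (C ^ 2 + 1) * (1 - ‖stepChar p θ‖) := by
    calc (h : ℝ) ^ 2 / Real.pi ^ 2 * θ ^ 2 = (2 / Real.pi) ^ 2 * (h * θ / 2) ^ 2 := by ring
      _ ≤ _ := h3
      _ ≤ _ := by nlinarith
  have h5 : (h : ℝ) ^ 2 / (Real.pi ^ 2 * (C ^ 2 + 1)) * θ ^ 2 ≤ 1 - ‖stepChar p θ‖ := by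
    rw [← div_div, div_mul_eq_mul_div, div_le_iff₀ (by positivity)]
    linarith
  have h6 := Real.add_one_le_exp (-((h : ℝ) ^ 2 / (Real.pi ^ 2 * (C ^ 2 + 1))) * θ ^ 2)
  linarith

lemma continuous_stepChar {p : ℕ → ℝ} (hp : IsCriticalLaw p) : Continuous (stepChar p) := by
  refine continuous_tsum (u := p) (fun j => by fun_prop) hp.hasSum.summable fun j θ => ?_
  rw [norm_mul, norm_exp_ofReal_mul_I_pow, mul_one, Complex.norm_real,
    Real.norm_of_nonneg (hp.nonneg j)]

/-- Local upper bound for the walk: `P(ξ_1 + ⋯ + ξ_n = m) ≤ K / √n`. -/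
lemma exists_stepProb_le {p : ℕ → ℝ} (hp : IsCriticalLaw p) :
    ∃ K : ℝ, 0 < K ∧ ∀ n m : ℕ, 0 < n → stepProb p n m ≤ K / √n := by
  obtain ⟨h, h0, hdvd, c, hc, hdecay⟩ := exists_period hp
  have hπ := Real.pi_pos
  have hh0 : (0 : ℝ) < h := by exact_mod_cast h0
  refine ⟨h / (2 * Real.pi) * √(Real.pi / c), by positivity, fun n m hn => ?_⟩
  have hn0 : (0 : ℝ) < n := by exact_mod_cast hn
  have hnn := stepProb_nonneg hp.nonneg n m
  by_cases hm : h ∣ m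
  swap
  · have : stepProb p n m = 0 := by
      by_contra hne
      exact hm (dvd_of_stepProb_ne_zero hdvd hne)
    rw [this]; positivity
  have hF := stepProb_eq_integral hp.nonneg hp.hasSum.summable h0 hdvd n m hm
  have h1 : stepProb p n m = ‖(stepProb p n m : ℂ)‖ := by
    rw [Complex.norm_real, Real.norm_of_nonneg hnn]
  rw [h1, hF, norm_mul, mul_div_assoc]
  have h2 : ‖(h : ℂ) / (2 * Real.pi)‖ = h / (2 * Real.pi) := by
    rw [norm_div, norm_mul, Complex.norm_real, Real.norm_of_nonneg hπ.le]; simp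
  rw [h2]
  refine mul_le_mul_of_nonneg_left ?_ (by positivity)
  have hab : -(Real.pi / h) ≤ Real.pi / h := by
    have : 0 < Real.pi / h := by positivity
    linarith
  have hgauss : MeasureTheory.Integrable fun θ : ℝ => Real.exp (-(c * n) * θ ^ 2) :=
    integrable_exp_neg_mul_sq (by positivity)
  calc ‖∫ θ : ℝ in (-(Real.pi / h))..(Real.pi / h),
        stepChar p θ ^ n * Complex.exp (-(m * θ * Complex.I))‖
      ≤ ∫ θ : ℝ in (-(Real.pi / h))..(Real.pi / h), Real.exp (-(c * n) * θ ^ 2) := by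
        refine intervalIntegral.norm_integral_le_of_norm_le hab ?_ hgauss.intervalIntegrable
        refine Filter.Eventually.of_forall fun θ hθ => ?_
        have : -(m * θ * Complex.I) = ((-(m * θ) : ℝ) : ℂ) * Complex.I := by push_cast; ring
        rw [norm_mul, this, Complex.norm_exp_ofReal_mul_I, mul_one, norm_pow]
        have := hdecay θ (abs_le.2 ⟨hθ.1.le, hθ.2⟩)
        calc _ ≤ Real.exp (-c * θ ^ 2) ^ n := pow_le_pow_left₀ (norm_nonneg _) this n
          _ = _ := by rw [← Real.exp_nat_mul]; ring_nf
    _ ≤ ∫ θ : ℝ, Real.exp (-(c * n) * θ ^ 2) := by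
        rw [intervalIntegral.integral_of_le hab]
        exact MeasureTheory.setIntegral_le_integral hgauss
          (Filter.Eventually.of_forall fun θ => (Real.exp_pos _).le)
    _ = √(Real.pi / c) / √n := by
        rw [integral_gaussian, ← Real.sqrt_div (by positivity), div_div]

open Filter Topology in
lemma norm_exp_sub_taylor_two_le (x : ℝ) :
    ‖Complex.exp (x * Complex.I) - (1 + x * Complex.I - x ^ 2 / 2)‖ ≤ 4 * x ^ 2 ∧
    ‖Complex.exp (x * Complex.I) - (1 + x * Complex.I - x ^ 2 / 2)‖ ≤ 4 * |x| ^ 3 := by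
  have hx : ‖(x : ℂ) * Complex.I‖ = |x| := by simp
  rcases le_or_gt |x| 1 with h | h
  · have h1 := Complex.exp_bound (x := x * Complex.I) (by rw [hx]; exact h) (n := 3) (by norm_num)
    have h2 : ∑ m ∈ Finset.range 3, ((x : ℂ) * Complex.I) ^ m / m.factorial =
        1 + x * Complex.I - x ^ 2 / 2 := by
      simp [Finset.sum_range_succ, mul_pow, Nat.factorial]; ring
    rw [h2, hx] at h1
    have h3 : ‖Complex.exp (x * Complex.I) - (1 + x * Complex.I - x ^ 2 / 2)‖ ≤ |x| ^ 3 := by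
      refine h1.trans ?_
      norm_num [Nat.factorial]
      have := pow_nonneg (abs_nonneg x) 3
      linarith
    have h4 : |x| ^ 3 ≤ x ^ 2 := by
      rw [← sq_abs, pow_succ]
      exact mul_le_of_le_one_right (by positivity) h
    have := pow_nonneg (abs_nonneg x) 3
    constructor <;> linarith
  · have h1 : ‖Complex.exp (x * Complex.I) - (1 + x * Complex.I - x ^ 2 / 2)‖ ≤
        1 + (1 + |x| + x ^ 2 / 2) := by
      refine (norm_sub_le _ _).trans (add_le_add (Complex.norm_exp_ofReal_mul_I x).le ?_)
      refine (norm_sub_le _ _).trans (add_le_add ((norm_add_le _ _).trans ?_) ?_)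
      · simp
      · simp
    have h2 : 1 + (1 + |x| + x ^ 2 / 2) ≤ 4 * x ^ 2 := by
      rw [← sq_abs]; nlinarith
    have h3 : x ^ 2 ≤ |x| ^ 3 := by
      rw [← sq_abs, pow_succ |x| 2]
      exact le_mul_of_one_le_right (by positivity) h.le
    constructor <;> linarith

lemma hasSum_mul_sub_one_sq {p : ℕ → ℝ} (hp : IsCriticalLaw p) :
    HasSum (fun j : ℕ => p j * ((j : ℝ) - 1) ^ 2) ((∑' i : ℕ, (i : ℝ) ^ 2 * p i) - 1) := by
  have := (hp.summable_sq.hasSum.sub (hp.hasSum_mean.mul_left 2)).add hp.hasSum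
  convert! this using 1
  · ext j; ring
  · ring

open Filter Topology in
/-- The central limit theorem at the level of characteristic functions. -/
lemma tendsto_stepChar_pow {p : ℕ → ℝ} (hp : IsCriticalLaw p) (s : ℝ) :
    Tendsto (fun n : ℕ => (stepChar p (s / √n) * Complex.exp (-((s / √n : ℝ) * Complex.I))) ^ n)
      atTop (𝓝 (Complex.exp (((-(((∑' i : ℕ, (i : ℝ) ^ 2 * p i) - 1) / 2) * s ^ 2 : ℝ)) : ℂ))) := by
  set v := (∑' i : ℕ, (i : ℝ) ^ 2 * p i) - 1 with hv
  have hvsum := hasSum_mul_sub_one_sq hp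
  rw [← hv] at hvsum
  apply Complex.tendsto_pow_exp_of_isLittleO_sub_add_div
  let r : ℝ → ℂ := fun x => Complex.exp (x * Complex.I) - (1 + x * Complex.I - x ^ 2 / 2)
  have hr : ∀ x, ‖r x‖ ≤ 4 * x ^ 2 ∧ ‖r x‖ ≤ 4 * |x| ^ 3 := norm_exp_sub_taylor_two_le
  have hchar : ∀ t : ℝ, stepChar p t * Complex.exp (-((t : ℝ) * Complex.I)) =
      1 - v / 2 * t ^ 2 + ∑' j : ℕ, (p j : ℂ) * r (((j : ℝ) - 1) * t) := by
    intro t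
    have hA : HasSum (fun j : ℕ => (p j : ℂ) * (1 + ((((j : ℝ) - 1) * t : ℝ) : ℂ) * Complex.I -
        ((((j : ℝ) - 1) * t : ℝ) : ℂ) ^ 2 / 2)) (1 - (v : ℂ) / 2 * (t : ℂ) ^ 2) := by
      have h0 := Complex.hasSum_ofReal.2 hp.hasSum
      have h1 := Complex.hasSum_ofReal.2 hp.hasSum_mean
      have h2 := Complex.hasSum_ofReal.2 hvsum
      have := (h0.add ((h1.sub h0).mul_right (t * Complex.I))).sub (h2.mul_right ((t : ℂ) ^ 2 / 2))
      convert! this using 1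
      · ext j; push_cast; ring
      · push_cast; ring
    have hsr : Summable fun j : ℕ => (p j : ℂ) * r (((j : ℝ) - 1) * t) := by
      refine Summable.of_norm_bounded (hvsum.summable.mul_right (4 * t ^ 2)) fun j => ?_
      rw [norm_mul, Complex.norm_real, Real.norm_of_nonneg (hp.nonneg j)]
      calc p j * ‖r (((j : ℝ) - 1) * t)‖ ≤ p j * (4 * (((j : ℝ) - 1) * t) ^ 2) :=
            mul_le_mul_of_nonneg_left (hr _).1 (hp.nonneg j)
        _ = _ := by ring
    rw [← hA.tsum_eq, ← hA.summable.tsum_add hsr, stepChar, ← tsum_mul_right]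
    refine tsum_congr fun j => ?_
    have : Complex.exp (t * Complex.I) ^ j * Complex.exp (-(t * Complex.I)) =
        Complex.exp ((((j : ℝ) - 1) * t : ℝ) * Complex.I) := by
      rw [← Complex.exp_nat_mul, ← Complex.exp_add]
      congr 1
      push_cast
      ring
    rw [mul_assoc, this]
    simp only [r]
    ring
  have hlim : Tendsto (fun n : ℕ => ∑' j : ℕ, (n : ℂ) * ((p j : ℂ) * r (((j : ℝ) - 1) * (s / √n))))
      atTop (𝓝 (∑' _ : ℕ, 0)) := by
    refine tendsto_tsum_of_dominated_convergence
      (bound := fun j => p j * ((j : ℝ) - 1) ^ 2 * (4 * s ^ 2))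
      (hvsum.summable.mul_right _) (fun j => ?_) ?_
    · have hz : Tendsto (fun n : ℕ => p j * (4 * |((j : ℝ) - 1) * s| ^ 3) * (√n)⁻¹)
          atTop (𝓝 0) := by
        rw [← mul_zero (p j * (4 * |((j : ℝ) - 1) * s| ^ 3))]
        exact Tendsto.const_mul _ (tendsto_inv_atTop_zero.comp
          (Real.tendsto_sqrt_atTop.comp tendsto_natCast_atTop_atTop))
      refine squeeze_zero_norm' ?_ hz
      filter_upwards [eventually_gt_atTop 0] with n hn
      have hn0 : (0 : ℝ) < n := by exact_mod_cast hn
      have hs0 : 0 < √(n : ℝ) := Real.sqrt_pos.2 hn0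
      rw [norm_mul, norm_mul, Complex.norm_natCast, Complex.norm_real,
        Real.norm_of_nonneg (hp.nonneg j)]
      calc (n : ℝ) * (p j * ‖r (((j : ℝ) - 1) * (s / √n))‖)
          ≤ n * (p j * (4 * |((j : ℝ) - 1) * (s / √n)| ^ 3)) := by
            gcongr
            · exact hp.nonneg j
            · exact (hr _).2
        _ = p j * (4 * |((j : ℝ) - 1) * s| ^ 3) * (n / √n ^ 3) := by
            rw [← mul_div_assoc, abs_div, abs_of_pos hs0]; ring
        _ = _ := by
            congr 1
            rw [pow_succ, Real.sq_sqrt hn0.le]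
            field_simp
    · filter_upwards [eventually_gt_atTop 0] with n hn j
      have hn0 : (0 : ℝ) < n := by exact_mod_cast hn
      rw [norm_mul, norm_mul, Complex.norm_natCast, Complex.norm_real,
        Real.norm_of_nonneg (hp.nonneg j)]
      calc (n : ℝ) * (p j * ‖r (((j : ℝ) - 1) * (s / √n))‖)
          ≤ n * (p j * (4 * (((j : ℝ) - 1) * (s / √n)) ^ 2)) := by
            gcongr
            · exact hp.nonneg j
            · exact (hr _).1
        _ = p j * ((j : ℝ) - 1) ^ 2 * (4 * s ^ 2) * (n / √n ^ 2) := by ring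
        _ = _ := by rw [Real.sq_sqrt hn0.le, div_self hn0.ne', mul_one]
  rw [tsum_zero] at hlim
  rw [Asymptotics.isLittleO_iff_tendsto']
  · refine hlim.congr' ?_
    filter_upwards [eventually_gt_atTop 0] with n hn
    have hn0 : (0 : ℝ) < n := by exact_mod_cast hn
    have hsq : ((√(n : ℝ) : ℝ) : ℂ) ^ 2 = n := by
      rw [← Complex.ofReal_pow, Real.sq_sqrt hn0.le]; simp
    have hnc : (n : ℂ) ≠ 0 := by exact_mod_cast hn.ne'
    rw [hchar, tsum_mul_left]
    generalize (∑' j : ℕ, (p j : ℂ) * r (((j : ℝ) - 1) * (s / √n))) = S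
    push_cast
    rw [div_pow, hsq]
    field_simp
    ring
  · filter_upwards [eventually_gt_atTop 0] with n hn h0
    have hnc : (n : ℂ) ≠ 0 := by exact_mod_cast hn.ne'
    simp [hnc] at h0

open Filter Topology MeasureTheory in
lemma exists_le_stepProb {p : ℕ → ℝ} (hp : IsCriticalLaw p) :
    ∃ h : ℕ, 0 < h ∧ (∀ j, p j ≠ 0 → h ∣ j) ∧ ∃ c : ℝ, 0 < c ∧ ∃ n₀ : ℕ, ∀ n : ℕ, n₀ ≤ n →
      h ∣ n → c / √(n + 1 : ℕ) ≤ stepProb p (n + 1) n := by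
  obtain ⟨h, h0, hdvd, c, hc, hdecay⟩ := exists_period hp
  refine ⟨h, h0, hdvd, ?_⟩
  have hπ := Real.pi_pos
  have hh0 : (0 : ℝ) < h := by exact_mod_cast h0
  set v := (∑' i : ℕ, (i : ℝ) ^ 2 * p i) - 1 with hv
  have hv0 : 0 < v := sub_pos.2 hp.one_lt_sq
  let g : ℕ → ℝ → ℂ := fun n θ =>
    (stepChar p θ * Complex.exp (-((θ : ℝ) * Complex.I))) ^ n * Complex.exp (θ * Complex.I)
  have hgc : ∀ n, Continuous (g n) := fun n => by
    have := continuous_stepChar hp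
    fun_prop
  let F : ℕ → ℝ → ℂ := fun n => (Set.Ioc (-(Real.pi * √n / h)) (Real.pi * √n / h)).indicator
    fun s => g n (s / √n)
  have hFint : ∀ n : ℕ, 0 < n → ∫ s, F n s =
      √n * ∫ θ in (-(Real.pi / h))..(Real.pi / h), g n θ := by
    intro n hn
    have hs0 : 0 < √(n : ℝ) := Real.sqrt_pos.2 (by exact_mod_cast hn)
    have hle : -(Real.pi * √n / h) ≤ Real.pi * √n / h := by
      have : 0 < Real.pi * √n / h := by positivity
      linarith
    have := intervalIntegral.integral_comp_div (a := -(Real.pi * √n / h)) (b := Real.pi * √n / h)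
      (g n) hs0.ne'
    rw [intervalIntegral.integral_of_le hle] at this
    rw [integral_indicator measurableSet_Ioc, this, Complex.real_smul]
    congr 2 <;> field_simp
  have hFlim : Tendsto (fun n => ∫ s, F n s) atTop
      (𝓝 (∫ s : ℝ, Complex.exp ((-(v / 2) * s ^ 2 : ℝ)))) := by
    refine tendsto_integral_of_dominated_convergence (fun s => Real.exp (-c * s ^ 2))
      (fun n => ?_) (integrable_exp_neg_mul_sq hc) (fun n => ?_) ?_
    · exact (((hgc n).comp (by fun_prop)).aestronglyMeasurable).indicator measurableSet_Ioc
    · refine Eventually.of_forall fun s => ?_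
      by_cases hs : s ∈ Set.Ioc (-(Real.pi * √n / h)) (Real.pi * √n / h)
      · simp only [F, Set.indicator_of_mem hs, g]
        have hn0 : 0 < √(n : ℝ) := by
          by_contra hcon
          have : √(n : ℝ) = 0 := le_antisymm (not_lt.1 hcon) (Real.sqrt_nonneg _)
          simp only [this, mul_zero, zero_div, neg_zero, Set.mem_Ioc] at hs
          linarith [hs.1, hs.2]
        have hnn : (0 : ℝ) < n := Real.sqrt_pos.1 hn0
        have e1 : -(((s / √n : ℝ) : ℂ) * Complex.I) = ((-(s / √n) : ℝ) : ℂ) * Complex.I := by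
          push_cast; ring
        rw [norm_mul, Complex.norm_exp_ofReal_mul_I, mul_one, norm_pow, norm_mul, e1,
          Complex.norm_exp_ofReal_mul_I, mul_one]
        have hd := hdecay (s / √n) (by
          rw [abs_div, abs_of_pos hn0, div_le_iff₀ hn0]
          have := abs_le.2 ⟨hs.1.le, hs.2⟩
          calc |s| ≤ _ := this
            _ = _ := by ring)
        calc _ ≤ Real.exp (-c * (s / √n) ^ 2) ^ n := pow_le_pow_left₀ (norm_nonneg _) hd n
          _ = _ := by
            rw [← Real.exp_nat_mul, div_pow, Real.sq_sqrt hnn.le]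
            congr 1
            field_simp
      · simp only [F, Set.indicator_of_notMem hs, norm_zero]
        exact (Real.exp_pos _).le
    · refine Eventually.of_forall fun s => ?_
      have h1 := tendsto_stepChar_pow hp s
      rw [← hv] at h1
      have h2 : Tendsto (fun n : ℕ => Complex.exp ((s / √n : ℝ) * Complex.I)) atTop (𝓝 1) := by
        have h3 : Tendsto (fun n : ℕ => s / √(n : ℝ)) atTop (𝓝 0) :=
          Tendsto.div_atTop tendsto_const_nhds
            (Real.tendsto_sqrt_atTop.comp tendsto_natCast_atTop_atTop)
        have h4 : Continuous fun x : ℝ => Complex.exp (x * Complex.I) := by fun_prop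
        have := (h4.tendsto 0).comp h3
        simpa [Function.comp_def] using this
      have h5 := h1.mul h2
      rw [mul_one] at h5
      refine h5.congr' ?_
      have h6 : Tendsto (fun n : ℕ => Real.pi * √(n : ℝ) / h) atTop atTop :=
        ((Real.tendsto_sqrt_atTop.comp tendsto_natCast_atTop_atTop).const_mul_atTop
          hπ).atTop_div_const hh0
      filter_upwards [h6.eventually_gt_atTop |s|] with n hn
      have hs : s ∈ Set.Ioc (-(Real.pi * √n / h)) (Real.pi * √n / h) :=
        ⟨(abs_lt.1 hn).1, (abs_lt.1 hn).2.le⟩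
      simp only [F, Set.indicator_of_mem hs, g]
  have hlimval : (∫ s : ℝ, Complex.exp ((-(v / 2) * s ^ 2 : ℝ))) =
      ((√(Real.pi / (v / 2)) : ℝ) : ℂ) := by
    simp_rw [← Complex.ofReal_exp]
    rw [integral_complex_ofReal, integral_gaussian]
  rw [hlimval] at hFlim
  have hpos : 0 < √(Real.pi / (v / 2)) := by positivity
  have hnorm := hFlim.norm
  rw [Complex.norm_real, Real.norm_of_nonneg hpos.le] at hnorm
  obtain ⟨n₀, hn₀⟩ := eventually_atTop.1 (hnorm.eventually (lt_mem_nhds (half_lt_self hpos)))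
  refine ⟨h / (2 * Real.pi) * (√(Real.pi / (v / 2)) / 2), by positivity, n₀, fun n hn hdn => ?_⟩
  have hkey := hn₀ (n + 1) (by omega)
  rw [hFint (n + 1) n.succ_pos, norm_mul, Complex.norm_real,
    Real.norm_of_nonneg (Real.sqrt_nonneg _)] at hkey
  have hFour := stepProb_eq_integral hp.nonneg hp.hasSum.summable h0 hdvd (n + 1) n hdn
  have hgeq : ∀ θ : ℝ, stepChar p θ ^ (n + 1) * Complex.exp (-(n * θ * Complex.I)) =
      g (n + 1) θ := by
    intro θ
    simp only [g]
    rw [mul_pow, mul_assoc (stepChar p θ ^ (n + 1)), ← Complex.exp_nat_mul, ← Complex.exp_add]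
    congr 2
    push_cast; ring
  simp_rw [hgeq] at hFour
  have h1 : stepProb p (n + 1) n = ‖(stepProb p (n + 1) n : ℂ)‖ := by
    rw [Complex.norm_real, Real.norm_of_nonneg (stepProb_nonneg hp.nonneg _ _)]
  have h2 : ‖(h : ℂ) / (2 * Real.pi)‖ = h / (2 * Real.pi) := by
    rw [norm_div, norm_mul, Complex.norm_real, Real.norm_of_nonneg hπ.le]; simp
  rw [h1, hFour, norm_mul, h2, mul_div_assoc]
  refine mul_le_mul_of_nonneg_left ?_ (by positivity)
  have hs0 : 0 < √((n + 1 : ℕ) : ℝ) := Real.sqrt_pos.2 (by positivity)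
  rw [div_le_iff₀ hs0, mul_comm]
  exact hkey.le

namespace PTree

lemma size_node (ts : List PTree) : (node ts).size = 1 + (ts.map size).sum := by
  rw [size]; simp

lemma size_pos (T : PTree) : 0 < T.size := by
  cases T; rw [size_node]; omega

/-- A tree is determined by the number of root subtrees and the tuple of root subtrees. -/
def equivSigma : PTree ≃ (d : ℕ) × (Fin d → PTree) :=
  (⟨fun T => match T with | node ts => ts, node, fun T => by cases T; rfl, fun _ => rfl⟩ :
    PTree ≃ List PTree).trans List.equivSigmaTuple

end PTree

open scoped ENNReal

/-- The weight of a tree as an extended nonnegative real. -/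
noncomputable def treeMass (p : ℕ → ℝ) (T : PTree) : ℝ≥0∞ := ENNReal.ofReal (weight p T)

/-- The total weight of the ordered forests of `k` trees with `n` nodes in total. -/
noncomputable def forestMass (p : ℕ → ℝ) (k n : ℕ) : ℝ≥0∞ :=
  ∑' v : Fin k → PTree, if ∑ i, (v i).size = n then ∏ i, treeMass p (v i) else 0

lemma weight_node (p : ℕ → ℝ) (ts : List PTree) :
    weight p (.node ts) = p ts.length * (ts.map (weight p)).prod := by
  rw [weight]; simp

lemma weight_nonneg {p : ℕ → ℝ} (hp : ∀ i, 0 ≤ p i) : ∀ T : PTree, 0 ≤ weight p T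
  | .node ts => by
    rw [weight_node]
    refine mul_nonneg (hp _) (List.prod_nonneg fun x hx => ?_)
    obtain ⟨T, hT, rfl⟩ := List.mem_map.1 hx
    exact weight_nonneg hp T
decreasing_by
  have := List.sizeOf_lt_of_mem hT
  simp only [PTree.node.sizeOf_spec]; omega

lemma treeMass_node {p : ℕ → ℝ} (hp : ∀ i, 0 ≤ p i) (ts : List PTree) :
    treeMass p (.node ts) = ENNReal.ofReal (p ts.length) * (ts.map (treeMass p)).prod := by
  rw [treeMass, weight_node, ENNReal.ofReal_mul (hp _)]
  congr 1
  induction ts with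
  | nil => simp
  | cons t ts ih =>
    rw [List.map_cons, List.prod_cons, ENNReal.ofReal_mul (weight_nonneg hp t), ih]
    simp [treeMass]

lemma treeMass_node_ofFn {p : ℕ → ℝ} (hp : ∀ i, 0 ≤ p i) {d : ℕ} (u : Fin d → PTree) :
    treeMass p (.node (List.ofFn u)) = ENNReal.ofReal (p d) * ∏ i, treeMass p (u i) := by
  rw [treeMass_node hp, List.length_ofFn, List.map_ofFn, List.prod_ofFn]
  rfl

lemma size_node_ofFn {d : ℕ} (u : Fin d → PTree) :
    (PTree.node (List.ofFn u)).size = 1 + ∑ i, (u i).size := by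
  rw [PTree.size_node, List.map_ofFn, List.sum_ofFn]
  rfl

lemma tsum_tree (f : PTree → ℝ≥0∞) :
    ∑' T, f T = ∑' d, ∑' u : Fin d → PTree, f (.node (List.ofFn u)) := by
  rw [← PTree.equivSigma.symm.tsum_eq, ENNReal.tsum_sigma']
  rfl

lemma tsum_fin_succ {α : Type*} {k : ℕ} (f : (Fin (k + 1) → α) → ℝ≥0∞) :
    ∑' v, f v = ∑' t, ∑' v : Fin k → α, f (Fin.cons t v) := by
  rw [← (Fin.consEquiv fun _ => α).tsum_eq, ENNReal.tsum_prod']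
  rfl

lemma tsum_fin_add {α : Type*} {k l : ℕ} (f : (Fin (k + l) → α) → ℝ≥0∞) :
    ∑' v, f v = ∑' u : Fin k → α, ∑' v : Fin l → α, f (Fin.append u v) := by
  rw [← (Fin.appendEquiv k l).tsum_eq, ENNReal.tsum_prod']
  rfl

lemma forestMass_zero_left (p : ℕ → ℝ) (n : ℕ) : forestMass p 0 n = if n = 0 then 1 else 0 := by
  rw [forestMass, tsum_eq_single default (fun b hb => (hb (Subsingleton.elim _ _)).elim)]
  simp [eq_comm]

lemma forestMass_eq_zero_of_lt (p : ℕ → ℝ) {k n : ℕ} (h : n < k) : forestMass p k n = 0 := by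
  rw [forestMass, ENNReal.tsum_eq_zero]
  intro v
  rw [if_neg]
  have : k ≤ ∑ i, (v i).size := by
    calc k = ∑ _i : Fin k, 1 := by simp
      _ ≤ _ := Finset.sum_le_sum fun i _ => (v i).size_pos
  omega

lemma forestMass_succ_succ {p : ℕ → ℝ} (hp : ∀ i, 0 ≤ p i) (k n : ℕ) :
    forestMass p (k + 1) (n + 1) = ∑' d, ENNReal.ofReal (p d) * forestMass p (d + k) n := by
  rw [forestMass, tsum_fin_succ, tsum_tree]
  refine tsum_congr fun d => ?_
  rw [forestMass, tsum_fin_add, ← ENNReal.tsum_mul_left]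
  refine tsum_congr fun u => ?_
  rw [← ENNReal.tsum_mul_left]
  refine tsum_congr fun v => ?_
  simp only [Fin.sum_univ_succ, Fin.cons_zero, Fin.cons_succ, Fin.prod_univ_succ, size_node_ofFn,
    Fin.sum_univ_add, Fin.prod_univ_add, Fin.append_left, Fin.append_right, treeMass_node_ofFn hp,
    mul_ite, mul_zero, mul_assoc]
  congr 1
  simp only [eq_iff_iff]
  omega

lemma sum_antidiagonal_mul_stepProb (p : ℕ → ℝ) (n m : ℕ) :
    ∑ kl ∈ Finset.HasAntidiagonal.antidiagonal m, (kl.1 : ℝ) * p kl.1 * stepProb p n kl.2 =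
      m / (n + 1) * stepProb p (n + 1) m := by
  have hn : (n : ℝ) + 1 ≠ 0 := by positivity
  cases m with
  | zero => simp
  | succ m =>
    have h := PowerSeries.derivative_pow (PowerSeries.mk p) (n + 1)
    have h1 := congrArg (PowerSeries.coeff m) h
    rw [PowerSeries.coeff_derivative, Nat.add_sub_cancel, mul_assoc,
      mul_comm (PowerSeries.mk p ^ n),
      ← map_natCast (PowerSeries.C (R := ℝ)), PowerSeries.coeff_C_mul, PowerSeries.coeff_mul] at h1
    simp only [PowerSeries.coeff_derivative, PowerSeries.coeff_mk] at h1
    rw [Finset.Nat.sum_antidiagonal_succ]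
    simp only [stepProb]
    rw [div_mul_eq_mul_div, eq_div_iff hn]
    push_cast at h1 ⊢
    rw [mul_comm ((m : ℝ) + 1), h1]
    simp only [zero_mul, zero_add]
    rw [mul_comm]
    congr 1
    exact Finset.sum_congr rfl fun kl _ => by ring

/-- The Kemperman formula for the total progeny of `k` Galton–Watson trees. -/
lemma forestMass_eq {p : ℕ → ℝ} (hp : ∀ i, 0 ≤ p i) {k n : ℕ} (hn : 0 < n) (hkn : k ≤ n) :
    forestMass p k n = ENNReal.ofReal (k / n * stepProb p n (n - k)) := by
  induction n generalizing k with
  | zero => omega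
  | succ n ih =>
    cases k with
    | zero => simp [forestMass_zero_left]
    | succ k =>
      rw [forestMass_succ_succ hp]
      rcases Nat.eq_zero_or_pos n with rfl | hn0
      · obtain rfl : k = 0 := by omega
        rw [tsum_eq_single 0]
        · simp [forestMass_zero_left, stepProb]
        · intro d hd
          rw [forestMass_eq_zero_of_lt p (by omega), mul_zero]
      obtain ⟨m, rfl⟩ := Nat.exists_eq_add_of_le (show k ≤ n by omega)
      rw [tsum_eq_sum (s := Finset.range (m + 1))]
      swap
      · intro d hd
        rw [Finset.mem_range] at hd
        rw [forestMass_eq_zero_of_lt p (by omega), mul_zero]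
      have hterm : ∀ d ∈ Finset.range (m + 1), ENNReal.ofReal (p d) * forestMass p (d + k) (k + m) =
          ENNReal.ofReal (p d * (((d + k : ℕ) : ℝ) / (k + m : ℕ) *
            stepProb p (k + m) (m - d))) := by
        intro d hd
        rw [Finset.mem_range] at hd
        rw [ih hn0 (by omega), ENNReal.ofReal_mul (hp d)]
        rw [show k + m - (d + k) = m - d by omega]
      rw [Finset.sum_congr rfl hterm, ← ENNReal.ofReal_sum_of_nonneg]
      swap
      · intro d _
        exact mul_nonneg (hp d) (mul_nonneg (by positivity) (stepProb_nonneg hp _ _))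
      congr 1
      rw [← Finset.Nat.sum_antidiagonal_eq_sum_range_succ
        (f := fun d l => p d * (((d + k : ℕ) : ℝ) / (k + m : ℕ) * stepProb p (k + m) l))]
      have h1 := sum_antidiagonal_mul_stepProb p (k + m) m
      have h2 := stepProb_succ p (k + m) m
      have hkm : ((k + m : ℕ) : ℝ) ≠ 0 := by exact_mod_cast hn0.ne'
      have hkm1 : ((k + m : ℕ) : ℝ) + 1 ≠ 0 := by positivity
      calc _ = (1 / ((k + m : ℕ) : ℝ)) *
            (∑ kl ∈ Finset.HasAntidiagonal.antidiagonal m,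
                (kl.1 : ℝ) * p kl.1 * stepProb p (k + m) kl.2 +
              k * ∑ kl ∈ Finset.HasAntidiagonal.antidiagonal m,
                p kl.1 * stepProb p (k + m) kl.2) := by
            rw [Finset.mul_sum, ← Finset.sum_add_distrib, Finset.mul_sum]
            refine Finset.sum_congr rfl fun kl _ => ?_
            push_cast
            ring
        _ = _ := by
            rw [h1, ← h2, show k + m + 1 - (k + 1) = m by omega]
            push_cast at hkm hkm1 ⊢
            field_simp
            ring

lemma exists_forestMass_le {p : ℕ → ℝ} (hp : IsCriticalLaw p) :
    ∃ K : ℝ, 0 < K ∧ ∀ k n : ℕ, 0 < n →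
      forestMass p k n ≤ ENNReal.ofReal (K * k * (n : ℝ) ^ (-(3 / 2) : ℝ)) := by
  obtain ⟨K, hK, hle⟩ := exists_stepProb_le hp
  refine ⟨K, hK, fun k n hn => ?_⟩
  have hn0 : (0 : ℝ) < n := by exact_mod_cast hn
  rcases lt_or_ge n k with h | h
  · rw [forestMass_eq_zero_of_lt p h]; exact zero_le
  rw [forestMass_eq hp.nonneg hn h]
  refine ENNReal.ofReal_le_ofReal ?_
  have hpow : (n : ℝ) ^ (-(3 / 2) : ℝ) = 1 / n * (1 / √n) := by
    rw [Real.sqrt_eq_rpow, one_div, one_div, ← Real.rpow_neg_one, ← Real.rpow_neg hn0.le,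
      ← Real.rpow_add hn0]
    norm_num
  calc (k : ℝ) / n * stepProb p n (n - k) ≤ k / n * (K / √n) :=
        mul_le_mul_of_nonneg_left (hle _ _ hn) (by positivity)
    _ = _ := by rw [hpow]; ring

lemma exists_le_forestMass_one {p : ℕ → ℝ} (hp : IsCriticalLaw p) :
    ∃ h : ℕ, 0 < h ∧ (∀ j, p j ≠ 0 → h ∣ j) ∧ (∀ n, forestMass p 1 (n + 1) ≠ 0 → h ∣ n) ∧
      ∃ c : ℝ, 0 < c ∧ ∃ n₀ : ℕ, ∀ n : ℕ, n₀ ≤ n → h ∣ n →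
      ENNReal.ofReal (c * ((n + 1 : ℕ) : ℝ) ^ (-(3 / 2) : ℝ)) ≤ forestMass p 1 (n + 1) := by
  obtain ⟨h, h0, hdvd, c, hc, n₀, hle⟩ := exists_le_stepProb hp
  refine ⟨h, h0, hdvd, fun n hn => ?_, c, hc, n₀, fun n hn hdn => ?_⟩
  · rw [forestMass_eq hp.nonneg n.succ_pos (by omega)] at hn
    refine dvd_of_stepProb_ne_zero hdvd (n := n + 1) fun h0 => hn ?_
    simp [h0]
  · rw [forestMass_eq hp.nonneg (Nat.add_pos_right n one_pos) (by omega), Nat.add_sub_cancel]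
    refine ENNReal.ofReal_le_ofReal ?_
    have hn0 : (0 : ℝ) < (n + 1 : ℕ) := by positivity
    have hpow : ((n + 1 : ℕ) : ℝ) ^ (-(3 / 2) : ℝ) = 1 / (n + 1 : ℕ) * (1 / √(n + 1 : ℕ)) := by
      rw [Real.sqrt_eq_rpow, one_div, one_div, ← Real.rpow_neg_one, ← Real.rpow_neg hn0.le,
        ← Real.rpow_add hn0]
      norm_num
    calc _ = ((1 : ℕ) : ℝ) / (n + 1 : ℕ) * (c / √(n + 1 : ℕ)) := by rw [hpow]; push_cast; ring
      _ ≤ _ := mul_le_mul_of_nonneg_left (hle n hn hdn) (by positivity)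

namespace PTree

lemma sortedSizesDesc_node_ofFn {D : ℕ} (u : Fin D → PTree) :
    ∃ e : Equiv.Perm (Fin D), Antitone (fun i => (u (e i)).size) ∧
      sortedSizesDesc (node (List.ofFn u)) = List.ofFn fun i => (u (e i)).size := by
  have hanti : Antitone (fun i => (u (Tuple.sort (fun i => OrderDual.toDual (u i).size) i)).size) :=
    fun i j hij => Tuple.monotone_sort (fun i => OrderDual.toDual (u i).size) hij
  refine ⟨Tuple.sort fun i => OrderDual.toDual (u i).size, hanti, ?_⟩
  rw [sortedSizesDesc]
  refine List.Perm.eq_of_pairwise (le := (· ≥ ·)) (fun a b _ _ h1 h2 => le_antisymm h2 h1)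
    (List.pairwise_insertionSort _ _) (List.pairwise_ofFn.2 fun i j hij => hanti hij.le) ?_
  refine (List.perm_insertionSort _ _).trans ?_
  rw [childSizes, List.map_ofFn]
  exact (Equiv.Perm.ofFn_comp_perm _ (PTree.size ∘ u)).symm

lemma NkPlus_node_ofFn {r d : ℕ} (u : Fin (r + d) → PTree) :
    ∃ e : Equiv.Perm (Fin (r + d)), Antitone (fun i => (u (e i)).size) ∧
      NkPlus (r + 1) (node (List.ofFn u)) = ∑ j : Fin d, (u (e (Fin.natAdd r j))).size := by
  obtain ⟨e, he, hs⟩ := sortedSizesDesc_node_ofFn u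
  refine ⟨e, he, ?_⟩
  rw [NkPlus, hs, Nat.add_sub_cancel, List.ofFn_add, List.drop_left' (List.length_ofFn),
    List.sum_ofFn]

lemma NkPlus_node_ofFn_of_le {r D : ℕ} (h : D ≤ r) (u : Fin D → PTree) :
    NkPlus (r + 1) (node (List.ofFn u)) = 0 := by
  obtain ⟨e, -, hs⟩ := sortedSizesDesc_node_ofFn u
  rw [NkPlus, hs, List.drop_eq_nil_of_le (by simpa using h), List.sum_nil]

lemma Nk_le_NkPlus (k : ℕ) (T : PTree) : Nk k T ≤ NkPlus k T := by
  rw [Nk, NkPlus]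
  generalize sortedSizesDesc T = l
  rw [List.getD_eq_getElem?_getD, ← List.head?_drop]
  cases l.drop (k - 1) <;> simp

end PTree

lemma Fin.exists_perm_castAdd {r d : ℕ} (f : Fin r ↪ Fin (r + d)) :
    ∃ e : Equiv.Perm (Fin (r + d)), ∀ i, e (Fin.castAdd d i) = f i := by
  classical
  let e₀ : {x // x ∈ Set.range (Fin.castAdd d : Fin r → Fin (r + d))} ≃ {x // x ∈ Set.range f} :=
    (Equiv.ofInjective _ (Fin.castAdd_injective r d)).symm.trans (Equiv.ofInjective f f.injective)
  refine ⟨e₀.extendSubtype, fun i => ?_⟩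
  rw [Equiv.extendSubtype_apply_of_mem _ _ ⟨i, rfl⟩]
  simp [e₀]

/-- For a tuple of `r + d` numbers whose first `r` entries contain the largest one in first place
and dominate the average of the other ones: the value of `g` at the sum of the other ones. -/
noncomputable def restValue (g : ℕ → ℝ≥0∞) {s d : ℕ} (N : ℕ) (a : Fin (s + 1 + d) → ℕ) : ℝ≥0∞ :=
  if (∀ i : Fin (s + 1), a (Fin.castAdd d i) ≤ a (Fin.castAdd d 0) ∧
      ∑ j : Fin d, a (Fin.natAdd (s + 1) j) ≤ d * a (Fin.castAdd d i)) ∧ ∑ i, a i = N then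
    g (∑ j : Fin d, a (Fin.natAdd (s + 1) j)) else 0

lemma exists_le_sum_restValue (g : ℕ → ℝ≥0∞) {s d : ℕ} :
    ∃ E : (Fin (s + 1) ↪ Fin (s + 1 + d)) → Equiv.Perm (Fin (s + 1 + d)),
      ∀ (N : ℕ) (u : Fin (s + 1 + d) → PTree),
      (if ∑ i, (u i).size = N then g (PTree.NkPlus (s + 2) (.node (List.ofFn u))) else 0) ≤
        ∑ f, restValue g N fun i => (u (E f i)).size := by
  choose E hE using fun f : Fin (s + 1) ↪ Fin (s + 1 + d) => Fin.exists_perm_castAdd f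
  refine ⟨E, fun N u => ?_⟩
  split_ifs with hN
  swap
  · exact zero_le
  obtain ⟨e, he, hs⟩ := PTree.NkPlus_node_ofFn u
  let f : Fin (s + 1) ↪ Fin (s + 1 + d) := (Fin.castAddEmb d).trans e.toEmbedding
  have hf : ∀ i, E f (Fin.castAdd d i) = e (Fin.castAdd d i) := fun i => hE f i
  have htot : ∀ e' : Equiv.Perm (Fin (s + 1 + d)), ∑ i, (u (e' i)).size = N := fun e' => by
    rw [← hN]; exact Equiv.sum_comp e' fun i => (u i).size
  have hrest : ∑ j : Fin d, (u (E f (Fin.natAdd (s + 1) j))).size =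
      ∑ j : Fin d, (u (e (Fin.natAdd (s + 1) j))).size := by
    have h1 := htot (E f)
    have h2 := htot e
    rw [Fin.sum_univ_add] at h1 h2
    simp only [hf] at h1
    omega
  refine le_trans (le_of_eq ?_) (Finset.single_le_sum (fun _ _ => zero_le) (Finset.mem_univ f))
  rw [restValue, if_pos, hs, hrest]
  refine ⟨fun i => ?_, htot _⟩
  simp only [hrest, hf]
  refine ⟨he (by simp [Fin.le_def]), ?_⟩
  calc _ ≤ ∑ _j : Fin d, (u (e (Fin.castAdd d i))).size :=
        Finset.sum_le_sum fun j _ => he (by simp [Fin.le_def]; omega)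
    _ = _ := by simp

lemma tsum_prod_mul_NkPlus_le (w : PTree → ℝ≥0∞) (g : ℕ → ℝ≥0∞) (s d N : ℕ) :
    ∑' u : Fin (s + 1 + d) → PTree, (∏ i, w (u i)) *
        (if ∑ i, (u i).size = N then g (PTree.NkPlus (s + 2) (.node (List.ofFn u))) else 0) ≤
      (s + 1 + d : ℕ) ^ (s + 1) *
        ∑' u : Fin (s + 1 + d) → PTree, (∏ i, w (u i)) * restValue g N fun i => (u i).size := by
  obtain ⟨E, hE⟩ := exists_le_sum_restValue g (s := s) (d := d)
  calc _ ≤ ∑' u : Fin (s + 1 + d) → PTree,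
        ∑ f, (∏ i, w (u i)) * restValue g N fun i => (u (E f i)).size := by
        refine ENNReal.tsum_le_tsum fun u => ?_
        rw [← Finset.mul_sum]
        gcongr
        exact hE N u
    _ = ∑ f : Fin (s + 1) ↪ Fin (s + 1 + d), ∑' u : Fin (s + 1 + d) → PTree,
        (∏ i, w (u i)) * restValue g N fun i => (u i).size := by
        rw [Summable.tsum_finsetSum fun _ _ => ENNReal.summable]
        refine Finset.sum_congr rfl fun f _ => ?_
        rw [← ((E f).arrowCongr (Equiv.refl PTree)).symm.tsum_eq
          (fun u => (∏ i, w (u i)) * restValue g N fun i => (u i).size)]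
        refine tsum_congr fun u => ?_
        congr 1
        exact (Equiv.prod_comp (E f) fun i => w (u i)).symm
    _ ≤ _ := by
        rw [Finset.sum_const, nsmul_eq_mul]
        gcongr
        rw [Finset.card_univ, Fintype.card_embedding_eq, Fintype.card_fin, Fintype.card_fin]
        exact_mod_cast Nat.descFactorial_le_pow _ _

/-- The total weight of the trees whose size is at least `m / d`. -/
noncomputable def treeTail (p : ℕ → ℝ) (d m : ℕ) : ℝ≥0∞ :=
  ∑' t : PTree, treeMass p t * if m ≤ d * t.size then 1 else 0

lemma tsum_prod_treeMass_mul (p : ℕ → ℝ) (d : ℕ) (φ : ℕ → ℝ≥0∞) :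
    ∑' u : Fin d → PTree, (∏ i, treeMass p (u i)) * φ (∑ i, (u i).size) =
      ∑' m, forestMass p d m * φ m := by
  simp_rw [forestMass, ← ENNReal.tsum_mul_right]
  rw [ENNReal.tsum_comm]
  refine tsum_congr fun u => ?_
  rw [tsum_eq_single (∑ i, (u i).size)]
  · simp
  · intro m hm
    rw [if_neg hm.symm, zero_mul]

lemma tsum_treeMass_mul (p : ℕ → ℝ) (φ : ℕ → ℝ≥0∞) :
    ∑' t : PTree, treeMass p t * φ t.size = ∑' m, forestMass p 1 m * φ m := by
  rw [← tsum_prod_treeMass_mul, ← (Equiv.funUnique (Fin 1) PTree).tsum_eq]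
  simp

lemma tsum_fin_prod {α : Type*} (f : α → ℝ≥0∞) (k : ℕ) :
    ∑' v : Fin k → α, ∏ i, f (v i) = (∑' t, f t) ^ k := by
  induction k with
  | zero =>
    rw [tsum_eq_single default (fun b hb => (hb (Subsingleton.elim _ _)).elim)]
    simp
  | succ k ih =>
    rw [tsum_fin_succ]
    simp only [Fin.prod_univ_succ, Fin.cons_zero, Fin.cons_succ, ENNReal.tsum_mul_left,
      ENNReal.tsum_mul_right, ih, pow_succ, mul_comm]

lemma tsum_prod_mul_forall {α : Type*} (f : α → ℝ≥0∞) (P : α → Prop) [DecidablePred P] (k : ℕ) :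
    ∑' v : Fin k → α, (∏ i, f (v i)) * (if ∀ i, P (v i) then 1 else 0) =
      (∑' t, f t * if P t then 1 else 0) ^ k := by
  rw [← tsum_fin_prod]
  refine tsum_congr fun v => ?_
  rw [Finset.prod_mul_distrib, Finset.prod_ite_zero]
  simp

lemma tsum_restValue_le {p : ℕ → ℝ} {g : ℕ → ℝ≥0∞} (hg : Monotone g) (hg0 : g 0 = 0) {s : ℕ}
    (hs : s ≤ 2) (d N : ℕ) {κ β : ℝ≥0∞}
    (hκ : ∀ a, N ≤ 8 * a → forestMass p 1 a ≤ κ)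
    (hβ : ∀ m, N ≤ 2 * m → forestMass p d m ≤ β) :
    ∑' u : Fin (s + 1 + d) → PTree,
        (∏ i, treeMass p (u i)) * restValue g N (fun i => (u i).size) ≤
      ∑ m ∈ Finset.Icc 1 N, forestMass p d m * g m * treeTail p d m ^ s * κ +
        β * g N * treeTail p (2 * d) N ^ (s + 1) := by
  let A : (Fin (s + 1) → PTree) → ℕ → ℝ≥0∞ := fun v m =>
    if m ≤ N ∧ (∀ i : Fin s, m ≤ d * (v i.succ).size) ∧
      (v 0).size + (∑ i : Fin s, (v i.succ).size + m) = N ∧ N ≤ 8 * (v 0).size then g m else 0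
  let B : (Fin (s + 1) → PTree) → ℕ → ℝ≥0∞ := fun v m =>
    if (∀ i, N ≤ 2 * d * (v i).size) ∧ ∑ i, (v i).size + m = N ∧ N ≤ 2 * m then g m else 0
  have hsplit : ∀ (v : Fin (s + 1) → PTree) (m : ℕ),
      (if (∀ i, (v i).size ≤ (v 0).size ∧ m ≤ d * (v i).size) ∧ ∑ i, (v i).size + m = N then g m
        else 0) ≤ A v m + B v m := by
    intro v m
    split_ifs with h
    swap
    · exact zero_le
    obtain ⟨h1, h2⟩ := h
    by_cases h8 : N ≤ 8 * (v 0).size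
    · refine le_add_of_le_of_nonneg (le_of_eq ?_) zero_le
      rw [Fin.sum_univ_succ] at h2
      simp only [A]
      rw [if_pos ⟨by omega, fun i => (h1 _).2, by omega, h8⟩]
    · have h3 : ∑ i, (v i).size ≤ ∑ _i : Fin (s + 1), (v 0).size :=
        Finset.sum_le_sum fun i _ => (h1 i).1
      have h4 : ∑ i, (v i).size ≤ 3 * (v 0).size := by
        refine h3.trans ?_
        rw [Finset.sum_const, Finset.card_univ, Fintype.card_fin, smul_eq_mul]
        exact Nat.mul_le_mul_right _ (by omega)
      refine le_add_of_nonneg_of_le zero_le (le_of_eq ?_)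
      simp only [B]
      rw [if_pos]
      refine ⟨fun i => ?_, h2, by omega⟩
      have := (h1 i).2
      rw [mul_assoc]
      exact (show N ≤ 2 * m by omega).trans (Nat.mul_le_mul_left 2 this)
  have hA : ∑' v : Fin (s + 1) → PTree, (∏ i, treeMass p (v i)) *
      ∑' m, forestMass p d m * A v m ≤
      ∑ m ∈ Finset.Icc 1 N, forestMass p d m * g m * treeTail p d m ^ s * κ := by
    simp_rw [← ENNReal.tsum_mul_left]
    rw [ENNReal.tsum_comm]
    rw [tsum_eq_sum (s := Finset.Icc 1 N)]
    swap
    · intro m hm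
      rw [ENNReal.tsum_eq_zero]
      intro v
      rcases Nat.eq_zero_or_pos m with rfl | hm0
      · simp [A, hg0]
      · have : ¬ m ≤ N := fun h => hm (Finset.mem_Icc.2 ⟨hm0, h⟩)
        simp [A, this]
    refine Finset.sum_le_sum fun m _ => ?_
    rw [tsum_fin_succ, ENNReal.tsum_comm, treeTail, ← tsum_prod_mul_forall,
      ← ENNReal.tsum_mul_left, ← ENNReal.tsum_mul_right]
    refine ENNReal.tsum_le_tsum fun v => ?_
    calc _ ≤ ∑' t : PTree, (forestMass p d m * g m * ((∏ i, treeMass p (v i)) *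
          if ∀ i, m ≤ d * (v i).size then 1 else 0)) * (treeMass p t *
            if t.size + (∑ i, (v i).size + m) = N ∧ N ≤ 8 * t.size then 1 else 0) := by
          refine ENNReal.tsum_le_tsum fun t => ?_
          simp only [A, Fin.cons_zero, Fin.cons_succ, Fin.prod_univ_succ]
          by_cases h1 : ∀ i, m ≤ d * (v i).size
          · by_cases h2 : t.size + (∑ i, (v i).size + m) = N ∧ N ≤ 8 * t.size
            · rw [if_pos ⟨by omega, h1, h2⟩, if_pos h1, if_pos h2]
              exact le_of_eq (by ring)
            · rw [if_neg fun h => h2 h.2.2]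
              simp
          · rw [if_neg fun h => h1 h.2.1]
            simp
      _ ≤ _ := by
          rw [ENNReal.tsum_mul_left]
          gcongr
          rw [tsum_treeMass_mul p fun a =>
            if a + (∑ i, (v i).size + m) = N ∧ N ≤ 8 * a then 1 else 0,
            tsum_eq_single (N - (∑ i, (v i).size + m))]
          · split_ifs with h
            · rw [mul_one]; exact hκ _ h.2
            · simp
          · intro a ha
            rw [if_neg (by omega), mul_zero]
  have hB : ∑' v : Fin (s + 1) → PTree, (∏ i, treeMass p (v i)) *
      ∑' m, forestMass p d m * B v m ≤ β * g N * treeTail p (2 * d) N ^ (s + 1) := by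
    rw [treeTail, ← tsum_prod_mul_forall, ← ENNReal.tsum_mul_left]
    refine ENNReal.tsum_le_tsum fun v => ?_
    rw [mul_left_comm]
    gcongr
    rw [tsum_eq_single (N - ∑ i, (v i).size)]
    · simp only [B]
      split_ifs with h1 h2 h2
      · rw [mul_one]
        gcongr
        · exact hβ _ h1.2.2
        · exact hg (by omega)
      · exact (h2 h1.1).elim
      · simp
      · simp
    · intro m hm
      simp only [B]
      rw [if_neg (by omega), mul_zero]
  refine le_trans ?_ (add_le_add hA hB)
  rw [← ENNReal.tsum_add, tsum_fin_add]
  refine ENNReal.tsum_le_tsum fun v => ?_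
  rw [← mul_add, ← ENNReal.tsum_add]
  simp_rw [← mul_add]
  rw [← tsum_prod_treeMass_mul p d fun m => A v m + B v m, ← ENNReal.tsum_mul_left]
  refine ENNReal.tsum_le_tsum fun x => ?_
  simp only [Fin.prod_univ_add, Fin.append_left, Fin.append_right, mul_assoc]
  gcongr
  refine le_trans (le_of_eq ?_) (hsplit v _)
  simp only [restValue, Fin.append_left, Fin.append_right, Fin.sum_univ_add]

lemma rpow_neg_three_halves {x : ℝ} (hx : 0 < x) : x ^ (-(3 / 2) : ℝ) = 1 / (x * √x) := by
  rw [Real.sqrt_eq_rpow, ← Real.rpow_one_add' hx.le (by norm_num), one_div, ← Real.rpow_neg hx.le]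
  norm_num

lemma rpow_neg_three_halves_le {x : ℝ} (hx : 1 ≤ x) :
    x ^ (-(3 / 2) : ℝ) ≤ 6 * (1 / √x - 1 / √(x + 1)) := by
  have hx0 : 0 < x := by linarith
  have h0 : 0 < √x := Real.sqrt_pos.2 hx0
  have h1 : 0 < √(x + 1) := Real.sqrt_pos.2 (by linarith)
  have h2 : √(x + 1) ≤ 2 * √x := by
    rw [Real.sqrt_le_left (by positivity), mul_pow, Real.sq_sqrt hx0.le]; linarith
  have h3 := Real.mul_self_sqrt hx0.le
  have h4 := Real.mul_self_sqrt (show 0 ≤ x + 1 by linarith)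
  have h5 : 1 / √x - 1 / √(x + 1) = 1 / (√x * √(x + 1) * (√x + √(x + 1))) := by
    field_simp
    nlinarith
  rw [rpow_neg_three_halves hx0, h5, mul_one_div, div_le_div_iff₀ (by positivity) (by positivity),
    one_mul]
  calc √x * √(x + 1) * (√x + √(x + 1)) ≤ √x * (2 * √x) * (√x + 2 * √x) := by gcongr
    _ = 6 * (x * √x) := by rw [← h3]; simp only [Real.sqrt_mul_self h0.le]; ring

lemma exists_treeTail_le {p : ℕ → ℝ} (hp : IsCriticalLaw p) :
    ∃ C : ℝ, 0 < C ∧ ∀ d m : ℕ, 0 < m → treeTail p d m ≤ ENNReal.ofReal (C * √(d / m)) := by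
  obtain ⟨K, hK, hle⟩ := exists_forestMass_le hp
  refine ⟨6 * K, by positivity, fun d m hm => ?_⟩
  rcases Nat.eq_zero_or_pos d with rfl | hd
  · rw [treeTail, ENNReal.tsum_eq_zero.2 fun t => ?_]
    · exact zero_le
    · rw [if_neg (by omega), mul_zero]
  obtain ⟨a₀, ha₀⟩ : ∃ a₀ : ℕ, ∀ a, m ≤ d * a ↔ a₀ ≤ a :=
    ⟨m ⌈/⌉ d, fun a => (ceilDiv_le_iff_le_mul hd).symm⟩
  have hpos : 0 < a₀ := by
    by_contra h
    have := (ha₀ 0).2 (by omega)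
    omega
  have hm' : (0 : ℝ) < m := by exact_mod_cast hm
  have hd' : (0 : ℝ) < d := by exact_mod_cast hd
  have ha' : (0 : ℝ) < a₀ := by exact_mod_cast hpos
  rw [treeTail, tsum_treeMass_mul p fun a => if m ≤ d * a then 1 else 0]
  refine ENNReal.tsum_le_of_sum_range_le fun n => ?_
  calc _ ≤ ∑ a ∈ Finset.Ico a₀ (max n a₀), ENNReal.ofReal (6 * K * (1 / √a - 1 / √(a + 1))) := by
        simp only [mul_ite, mul_one, mul_zero]
        rw [← Finset.sum_filter]
        refine (Finset.sum_le_sum fun a ha => ?_).trans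
          (Finset.sum_le_sum_of_subset (s := {a ∈ Finset.range n | m ≤ d * a}) fun a ha => ?_)
        · rw [Finset.mem_filter, ha₀] at ha
          have h1 : (1 : ℝ) ≤ a := Nat.one_le_cast.2 (by omega)
          refine (hle 1 a (by omega)).trans (ENNReal.ofReal_le_ofReal ?_)
          have := mul_le_mul_of_nonneg_left (rpow_neg_three_halves_le h1) hK.le
          push_cast
          linarith
        · rw [Finset.mem_filter, ha₀, Finset.mem_range] at ha
          rw [Finset.mem_Ico]
          omega
    _ = ENNReal.ofReal (6 * K * (1 / √a₀ - 1 / √(max n a₀ : ℕ))) := by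
        rw [← ENNReal.ofReal_sum_of_nonneg, ← Finset.mul_sum]
        · congr 2
          have := Finset.sum_Ico_sub (fun a : ℕ => -(1 / √(a : ℝ))) (le_max_right n a₀)
          push_cast at this ⊢
          rw [sub_eq_add_neg, add_comm, ← sub_neg_eq_add, ← this]
          exact Finset.sum_congr rfl fun a _ => by ring
        · intro a ha
          rw [Finset.mem_Ico] at ha
          have h1 : (1 : ℝ) ≤ a := Nat.one_le_cast.2 (by omega)
          have := (Real.rpow_pos_of_pos (by linarith) _).le.trans (rpow_neg_three_halves_le h1)
          rw [mul_right_comm]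
          exact mul_nonneg this hK.le
    _ ≤ _ := by
        refine ENNReal.ofReal_le_ofReal (mul_le_mul_of_nonneg_left ?_ (by positivity))
        refine (sub_le_self _ (by positivity)).trans ?_
        rw [← Real.sqrt_one, ← Real.sqrt_div zero_le_one]
        refine Real.sqrt_le_sqrt ?_
        rw [div_le_div_iff₀ ha' hm', one_mul]
        exact_mod_cast (ha₀ a₀).2 le_rfl

lemma rpow_neg_le_of_le_mul {x y c r : ℝ} (hx : 0 < x) (hc : 0 < c) (hr : 0 ≤ r) (h : x ≤ c * y) :
    y ^ (-r) ≤ c ^ r * x ^ (-r) := by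
  have hy : x / c ≤ y := by rw [div_le_iff₀ hc]; linarith
  refine (Real.rpow_le_rpow_of_nonpos (by positivity) hy (by linarith)).trans (le_of_eq ?_)
  rw [Real.div_rpow hx.le hc.le, Real.rpow_neg hc.le, div_inv_eq_mul, mul_comm]

lemma treeTail_le_total (p : ℕ → ℝ) (d m : ℕ) : treeTail p d m ≤ treeTail p 1 1 := by
  refine ENNReal.tsum_le_tsum fun t => ?_
  have := t.size_pos
  gcongr
  rw [if_pos (show 1 ≤ 1 * t.size by omega)]
  split_ifs <;> simp

/-- The quantity controlling the expectation of `g (N_{k+})`, with `k = s + 2`. -/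
noncomputable def restBound (g : ℕ → ℝ) (s e N : ℕ) : ℝ :=
  ∑ m ∈ Finset.Icc 1 N, g m * (m : ℝ) ^ (-(3 / 2) : ℝ) * (1 / √m) ^ s + g N * (1 / √N) ^ e

lemma sqrt_pow_le {x : ℝ} (hx : 1 ≤ x) {e : ℕ} (he : e ≤ 2) : √x ^ e ≤ x :=
  (pow_le_pow_right₀ (Real.one_le_sqrt.2 hx) he).trans (Real.sq_sqrt (by linarith)).le

lemma exists_tsum_restValue_le {p : ℕ → ℝ} (hp : IsCriticalLaw p) {s e : ℕ} (hs : s ≤ 2)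
    (he : e ≤ 2) (hes : e ≤ s + 1) :
    ∃ M : ℝ, 0 < M ∧ ∀ g : ℕ → ℝ, Monotone g → g 0 = 0 → ∀ d N : ℕ, 0 < N →
      ∑' u : Fin (s + 1 + d) → PTree, (∏ i, treeMass p (u i)) *
          restValue (fun m => ENNReal.ofReal (g m)) N (fun i => (u i).size) ≤
        ENNReal.ofReal (M * (s + 1 + d : ℕ) ^ 2 * (N : ℝ) ^ (-(3 / 2) : ℝ) *
          restBound g s e N) := by
  obtain ⟨K, hK, hforest⟩ := exists_forestMass_le hp
  obtain ⟨C₀, hC₀, htail₀⟩ := exists_treeTail_le hp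
  obtain ⟨C, hC, hCC⟩ : ∃ C, 1 ≤ C ∧ C₀ ≤ C := ⟨max 1 C₀, le_max_left _ _, le_max_right _ _⟩
  have htail : ∀ d m : ℕ, 0 < m → treeTail p d m ≤ ENNReal.ofReal (C * √(d / m)) := fun d m hm =>
    (htail₀ d m hm).trans (ENNReal.ofReal_le_ofReal (by gcongr))
  have htot : ∀ d m : ℕ, treeTail p d m ≤ ENNReal.ofReal C := fun d m =>
    (treeTail_le_total p d m).trans ((htail 1 1 one_pos).trans (by simp))
  refine ⟨K ^ 2 * 8 ^ (3 / 2 : ℝ) * C ^ 2 + K * 2 ^ (3 / 2 : ℝ) * (2 * C) ^ 3, by positivity,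
    fun g hg hg0 d N hN => ?_⟩
  have hgnn : ∀ m, 0 ≤ g m := fun m => hg0 ▸ hg (Nat.zero_le m)
  set D : ℕ := s + 1 + d with hD
  have hN' : (0 : ℝ) < N := by exact_mod_cast hN
  have hD1 : (1 : ℝ) ≤ D := Nat.one_le_cast.2 (by omega)
  have hdD : (d : ℝ) ≤ D := Nat.cast_le.2 (by omega)
  have hκ : ∀ a, N ≤ 8 * a → forestMass p 1 a ≤
      ENNReal.ofReal (K * (8 ^ (3 / 2 : ℝ) * (N : ℝ) ^ (-(3 / 2) : ℝ))) := by
    intro a ha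
    refine (hforest 1 a (by omega)).trans (ENNReal.ofReal_le_ofReal ?_)
    rw [Nat.cast_one, mul_one]
    gcongr
    exact rpow_neg_le_of_le_mul hN' (by norm_num) (by norm_num) (by exact_mod_cast ha)
  have hβ : ∀ m, N ≤ 2 * m → forestMass p d m ≤
      ENNReal.ofReal (K * D * (2 ^ (3 / 2 : ℝ) * (N : ℝ) ^ (-(3 / 2) : ℝ))) := by
    intro m hm
    refine (hforest d m (by omega)).trans (ENNReal.ofReal_le_ofReal ?_)
    gcongr
    exact rpow_neg_le_of_le_mul hN' (by norm_num) (by norm_num) (by exact_mod_cast hm)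
  have hg' : Monotone fun m => ENNReal.ofReal (g m) := fun a b h =>
    ENNReal.ofReal_le_ofReal (hg h)
  refine (tsum_restValue_le hg' (by simp [hg0]) hs d N hκ hβ).trans ?_
  have htailpow : treeTail p (2 * d) N ^ (s + 1) ≤
      ENNReal.ofReal ((2 * C) ^ 3 * D * (1 / √N) ^ e) := by
    calc treeTail p (2 * d) N ^ (s + 1) =
          treeTail p (2 * d) N ^ e * treeTail p (2 * d) N ^ (s + 1 - e) := by
          rw [← pow_add]; congr 1; omega
      _ ≤ ENNReal.ofReal (C * √((2 * d : ℕ) / N)) ^ e * ENNReal.ofReal C ^ (s + 1 - e) := by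
          gcongr
          · exact htail _ _ hN
          · exact htot _ _
      _ = ENNReal.ofReal ((C * √((2 * d : ℕ) / N)) ^ e * C ^ (s + 1 - e)) := by
          rw [← ENNReal.ofReal_pow (by positivity), ← ENNReal.ofReal_pow (by positivity),
            ← ENNReal.ofReal_mul (by positivity)]
      _ ≤ _ := by
          refine ENNReal.ofReal_le_ofReal ?_
          have h1 : √((2 * d : ℕ) / N) ≤ 2 * √D * (1 / √N) := by
            rw [Real.sqrt_div (by positivity), mul_one_div]
            gcongr
            rw [show (2 : ℝ) = √4 by rw [show (4 : ℝ) = 2 ^ 2 by norm_num, Real.sqrt_sq]; norm_num,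
              ← Real.sqrt_mul (by norm_num)]
            refine Real.sqrt_le_sqrt ?_
            push_cast
            linarith
          calc (C * √((2 * d : ℕ) / N)) ^ e * C ^ (s + 1 - e)
              ≤ (C * (2 * √D * (1 / √N))) ^ e * (2 * C) ^ (s + 1 - e) := by
                gcongr
                linarith
            _ = (2 * C) ^ (e + (s + 1 - e)) * √D ^ e * (1 / √N) ^ e := by
                rw [pow_add]; ring
            _ ≤ (2 * C) ^ 3 * D * (1 / √N) ^ e := by
                gcongr
                · linarith
                · omega
                · exact sqrt_pow_le hD1 he
  have hsum : ∀ m ∈ Finset.Icc 1 N, forestMass p d m * ENNReal.ofReal (g m) *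
      treeTail p d m ^ s * ENNReal.ofReal (K * (8 ^ (3 / 2 : ℝ) * (N : ℝ) ^ (-(3 / 2) : ℝ))) ≤
      ENNReal.ofReal (K * D * (m : ℝ) ^ (-(3 / 2) : ℝ) * g m * (C ^ 2 * D * (1 / √m) ^ s) *
        (K * (8 ^ (3 / 2 : ℝ) * (N : ℝ) ^ (-(3 / 2) : ℝ)))) := by
    intro m hm
    have hm0 : 0 < m := (Finset.mem_Icc.1 hm).1
    have := hgnn m
    rw [ENNReal.ofReal_mul (q := K * _) (by positivity),
      ENNReal.ofReal_mul (q := C ^ 2 * D * _) (by positivity),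
      ENNReal.ofReal_mul (q := g m) (by positivity)]
    gcongr ?_ * _ * ?_ * _
    · refine (hforest d m hm0).trans (ENNReal.ofReal_le_ofReal ?_)
      gcongr
    · refine (pow_le_pow_left' (htail d m hm0) s).trans ?_
      rw [← ENNReal.ofReal_pow (by positivity)]
      refine ENNReal.ofReal_le_ofReal ?_
      calc (C * √(d / m)) ^ s ≤ (C * (√D * (1 / √m))) ^ s := by
            gcongr
            rw [Real.sqrt_div (by positivity), mul_one_div]
            gcongr
        _ = C ^ s * √D ^ s * (1 / √m) ^ s := by ring
        _ ≤ C ^ 2 * D * (1 / √m) ^ s := by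
            gcongr
            exact sqrt_pow_le hD1 hs
  refine (add_le_add (Finset.sum_le_sum hsum) (mul_le_mul_right htailpow _)).trans ?_
  have hgN := hgnn N
  rw [← ENNReal.ofReal_sum_of_nonneg fun m _ => by have := hgnn m; positivity,
    ← ENNReal.ofReal_mul (by positivity), ← ENNReal.ofReal_mul (by positivity),
    ← ENNReal.ofReal_add (Finset.sum_nonneg fun m _ => by have := hgnn m; positivity)
      (by positivity)]
  refine ENNReal.ofReal_le_ofReal ?_
  have hS : 0 ≤ ∑ m ∈ Finset.Icc 1 N, g m * (m : ℝ) ^ (-(3 / 2) : ℝ) * (1 / √m) ^ s :=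
    Finset.sum_nonneg fun m _ => by have := hgnn m; positivity
  have hSeq : ∑ m ∈ Finset.Icc 1 N, (K * D * (m : ℝ) ^ (-(3 / 2) : ℝ) * g m *
      (C ^ 2 * D * (1 / √m) ^ s) * (K * (8 ^ (3 / 2 : ℝ) * (N : ℝ) ^ (-(3 / 2) : ℝ)))) =
      K ^ 2 * 8 ^ (3 / 2 : ℝ) * C ^ 2 * D ^ 2 * (N : ℝ) ^ (-(3 / 2) : ℝ) *
        ∑ m ∈ Finset.Icc 1 N, g m * (m : ℝ) ^ (-(3 / 2) : ℝ) * (1 / √m) ^ s := by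
    rw [Finset.mul_sum]
    exact Finset.sum_congr rfl fun m _ => by ring
  rw [hSeq, restBound]
  set S := ∑ m ∈ Finset.Icc 1 N, g m * (m : ℝ) ^ (-(3 / 2) : ℝ) * (1 / √m) ^ s
  have h1 : 0 ≤ K ^ 2 * 8 ^ (3 / 2 : ℝ) * C ^ 2 * D ^ 2 * (N : ℝ) ^ (-(3 / 2) : ℝ) *
    (g N * (1 / √N) ^ e) := by positivity
  have h2 : 0 ≤ K * 2 ^ (3 / 2 : ℝ) * (2 * C) ^ 3 * D ^ 2 * (N : ℝ) ^ (-(3 / 2) : ℝ) * S := by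
    positivity
  linarith

/-- The unnormalised expectation of `φ` over the trees of size `n`. -/
noncomputable def treeExp (p : ℕ → ℝ) (n : ℕ) (φ : PTree → ℝ) : ℝ≥0∞ :=
  ∑' T : PTree, treeMass p T * if T.size = n then ENNReal.ofReal (φ T) else 0

lemma exists_treeExp_NkPlus_le {p : ℕ → ℝ} (hp : IsCriticalLaw p) {s e : ℕ} (hs : s ≤ 2)
    (he : e ≤ 2) (hes : e ≤ s + 1) (hmom : Summable fun i : ℕ => (i : ℝ) ^ (s + 3) * p i) :
    ∃ M : ℝ, 0 < M ∧ ∀ g : ℕ → ℝ, Monotone g → g 0 = 0 → ∀ N : ℕ, 0 < N →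
      treeExp p (N + 1) (fun T => g (T.NkPlus (s + 2))) ≤
        ENNReal.ofReal (M * (N : ℝ) ^ (-(3 / 2) : ℝ) *
          restBound g s e N) := by
  obtain ⟨M, hM, hle⟩ := exists_tsum_restValue_le hp hs he hes
  have hE : 0 ≤ ∑' i : ℕ, (i : ℝ) ^ (s + 3) * p i :=
    tsum_nonneg fun i => mul_nonneg (by positivity) (hp.nonneg i)
  refine ⟨((∑' i : ℕ, (i : ℝ) ^ (s + 3) * p i) + 1) * M, by positivity,
    fun g hg hg0 N hN => ?_⟩
  have hgnn : ∀ m, 0 ≤ g m := fun m => hg0 ▸ hg (Nat.zero_le m)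
  have hB : 0 ≤ restBound g s e N := by
    refine add_nonneg (Finset.sum_nonneg fun m _ => ?_) ?_
    · have := hgnn m; positivity
    · have := hgnn N; positivity
  have hterm : ∀ D : ℕ, ∑' u : Fin D → PTree, treeMass p (.node (List.ofFn u)) *
      (if (PTree.node (List.ofFn u)).size = N + 1 then
        ENNReal.ofReal (g ((PTree.node (List.ofFn u)).NkPlus (s + 2))) else 0) ≤
      ENNReal.ofReal ((D : ℝ) ^ (s + 3) * p D) *
        ENNReal.ofReal (M * (N : ℝ) ^ (-(3 / 2) : ℝ) *
          restBound g s e N) := by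
    intro D
    rcases lt_or_ge D (s + 1) with h | h
    · rw [ENNReal.tsum_eq_zero.2 fun u => ?_]
      · exact zero_le
      · rw [PTree.NkPlus_node_ofFn_of_le h.le, hg0]
        simp
    obtain ⟨d, rfl⟩ := Nat.exists_eq_add_of_le h
    calc _ = ENNReal.ofReal (p (s + 1 + d)) * ∑' u : Fin (s + 1 + d) → PTree,
          (∏ i, treeMass p (u i)) * (if ∑ i, (u i).size = N then
            ENNReal.ofReal (g ((PTree.node (List.ofFn u)).NkPlus (s + 2))) else 0) := by
          rw [← ENNReal.tsum_mul_left]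
          refine tsum_congr fun u => ?_
          rw [treeMass_node_ofFn hp.nonneg, size_node_ofFn, mul_assoc]
          congr 3
          simp only [eq_iff_iff]
          omega
      _ ≤ ENNReal.ofReal (p (s + 1 + d)) * ((s + 1 + d : ℕ) ^ (s + 1) *
            ENNReal.ofReal (M * (s + 1 + d : ℕ) ^ 2 * (N : ℝ) ^ (-(3 / 2) : ℝ) *
              restBound g s e N)) := by
          gcongr
          refine (tsum_prod_mul_NkPlus_le (treeMass p) (fun m => ENNReal.ofReal (g m)) s d N).trans
            ?_
          gcongr
          exact hle g hg hg0 d N hN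
      _ = _ := by
          have h1 := hp.nonneg (s + 1 + d)
          rw [← ENNReal.ofReal_natCast, ← ENNReal.ofReal_pow (by positivity),
            ← ENNReal.ofReal_mul (by positivity), ← ENNReal.ofReal_mul h1,
            ← ENNReal.ofReal_mul (by positivity)]
          congr 1
          ring
  rw [treeExp, tsum_tree]
  refine (ENNReal.tsum_le_tsum hterm).trans ?_
  rw [ENNReal.tsum_mul_right, ← ENNReal.ofReal_tsum_of_nonneg
    (fun i => mul_nonneg (by positivity) (hp.nonneg i)) hmom, ← ENNReal.ofReal_mul hE]
  refine ENNReal.ofReal_le_ofReal ?_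
  have : 0 ≤ M * (N : ℝ) ^ (-(3 / 2) : ℝ) * restBound g s e N := by positivity
  linarith

lemma toReal_treeExp {p : ℕ → ℝ} (hp : ∀ i, 0 ≤ p i) (n : ℕ) {φ : PTree → ℝ}
    (hφ : ∀ T, 0 ≤ φ T) :
    (treeExp p n φ).toReal = ∑' T : {T : PTree // T.size = n}, weight p T.1 * φ T.1 := by
  have h1 : treeExp p n φ =
      ∑' T : {T : PTree // T.size = n}, ENNReal.ofReal (weight p T.1 * φ T.1) := by
    refine Eq.trans ?_ (tsum_subtype {T : PTree | T.size = n} fun T =>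
      ENNReal.ofReal (weight p T * φ T)).symm
    refine tsum_congr fun T => ?_
    rw [Set.indicator_apply, ENNReal.ofReal_mul (weight_nonneg hp T), treeMass, mul_ite, mul_zero]
    rfl
  rw [h1, ENNReal.tsum_toReal_eq fun _ => ENNReal.ofReal_ne_top]
  exact tsum_congr fun T => ENNReal.toReal_ofReal (mul_nonneg (weight_nonneg hp _) (hφ _))

lemma treeSum_eq {p : ℕ → ℝ} (hp : ∀ i, 0 ≤ p i) (n : ℕ) :
    treeSum p n = (forestMass p 1 n).toReal := by
  have h := toReal_treeExp hp n (φ := fun _ => 1) fun _ => zero_le_one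
  simp only [mul_one] at h
  rw [treeSum, ← h, treeExp]
  simp only [ENNReal.ofReal_one]
  rw [tsum_treeMass_mul p fun a => if a = n then 1 else 0, tsum_eq_single n]
  · simp
  · intro m hm
    simp [hm]

lemma condExp_eq {p : ℕ → ℝ} (hp : ∀ i, 0 ≤ p i) (n : ℕ) {φ : PTree → ℝ} (hφ : ∀ T, 0 ≤ φ T) :
    condExp p n φ = (treeExp p n φ).toReal / treeSum p n := by
  rw [condExp, toReal_treeExp hp n hφ]

lemma treeExp_mono (p : ℕ → ℝ) (n : ℕ) {φ ψ : PTree → ℝ} (h : ∀ T, φ T ≤ ψ T) :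
    treeExp p n φ ≤ treeExp p n ψ := by
  refine ENNReal.tsum_le_tsum fun T => ?_
  gcongr
  split_ifs
  · exact ENNReal.ofReal_le_ofReal (h T)
  · exact le_rfl

lemma forestMass_one_ne_zero {p : ℕ → ℝ} (hp : ∀ i, 0 ≤ p i) {n : ℕ} (hn : n ∈ gwSupport p) :
    forestMass p 1 n ≠ 0 := fun h => by
  have := hn.2
  rw [treeSum_eq hp, h] at this
  simp at this

lemma exists_treeSum_le {p : ℕ → ℝ} (hp : IsCriticalLaw p) :
    ∃ K : ℝ, 0 < K ∧ ∀ n : ℕ, 0 < n → treeSum p n ≤ K * (n : ℝ) ^ (-(3 / 2) : ℝ) := by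
  obtain ⟨K, hK, hle⟩ := exists_forestMass_le hp
  refine ⟨K, hK, fun n hn => ?_⟩
  rw [treeSum_eq hp.nonneg]
  refine ENNReal.toReal_le_of_le_ofReal (by positivity) ?_
  simpa using hle 1 n hn

lemma exists_le_treeSum {p : ℕ → ℝ} (hp : IsCriticalLaw p) :
    ∃ c : ℝ, 0 < c ∧ ∃ n₀ : ℕ, ∀ n : ℕ, n₀ ≤ n → n ∈ gwSupport p →
      c * (n : ℝ) ^ (-(3 / 2) : ℝ) ≤ treeSum p n := by
  obtain ⟨h, -, -, hdvd, c, hc, n₀, hle⟩ := exists_le_forestMass_one hp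
  obtain ⟨K, -, hK⟩ := exists_forestMass_le hp
  refine ⟨c, hc, n₀ + 1, fun n hn hmem => ?_⟩
  obtain ⟨n, rfl⟩ : ∃ m, n = m + 1 := ⟨n - 1, by omega⟩
  have h1 := hle n (by omega) (hdvd n (forestMass_one_ne_zero hp.nonneg hmem))
  rw [treeSum_eq hp.nonneg]
  exact (ENNReal.ofReal_le_iff_le_toReal
    ((hK 1 (n + 1) n.succ_pos).trans_lt ENNReal.ofReal_lt_top).ne).1 h1

lemma exists_condExp_le {p : ℕ → ℝ} (hp : IsCriticalLaw p) {s e : ℕ} (hs : s ≤ 2)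
    (he : e ≤ 2) (hes : e ≤ s + 1) (hmom : Summable fun i : ℕ => (i : ℝ) ^ (s + 3) * p i) :
    ∃ C : ℝ, 0 < C ∧ ∃ n₀ : ℕ, ∀ g : ℕ → ℝ, Monotone g → g 0 = 0 → ∀ φ : PTree → ℝ,
      (∀ T, 0 ≤ φ T) → (∀ T, φ T ≤ g (T.NkPlus (s + 2))) → ∀ n : ℕ, n₀ ≤ n → n ∈ gwSupport p →
      condExp p n φ ≤ C * restBound g s e (n - 1) ∧ treeExp p n φ ≠ ⊤ := by
  obtain ⟨M, hM, hle⟩ := exists_treeExp_NkPlus_le hp hs he hes hmom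
  obtain ⟨c, hc, n₀, hsum⟩ := exists_le_treeSum hp
  refine ⟨M * 2 ^ (3 / 2 : ℝ) / c, by positivity, n₀ + 2, fun g hg hg0 φ hφ hφg n hn hmem => ?_⟩
  have hgnn : ∀ m, 0 ≤ g m := fun m => hg0 ▸ hg (Nat.zero_le m)
  obtain ⟨N, rfl⟩ : ∃ m, n = m + 1 := ⟨n - 1, by omega⟩
  have hN : 0 < N := by omega
  have hB : 0 ≤ restBound g s e N := by
    refine add_nonneg (Finset.sum_nonneg fun m _ => ?_) ?_
    · have := hgnn m; positivity
    · have := hgnn N; positivity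
  have h1 := (treeExp_mono p (N + 1) hφg).trans (hle g hg hg0 N hN)
  refine ⟨?_, (h1.trans_lt ENNReal.ofReal_lt_top).ne⟩
  rw [condExp_eq hp.nonneg _ hφ, div_le_iff₀ hmem.2, Nat.add_sub_cancel]
  refine (ENNReal.toReal_le_of_le_ofReal (by positivity) h1).trans ?_
  have h2 := hsum (N + 1) (by omega) hmem
  have h3 : (N : ℝ) ^ (-(3 / 2) : ℝ) ≤ 2 ^ (3 / 2 : ℝ) * ((N + 1 : ℕ) : ℝ) ^ (-(3 / 2) : ℝ) :=
    rpow_neg_le_of_le_mul (by positivity) (by norm_num) (by norm_num)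
      (by exact_mod_cast (by omega : N + 1 ≤ 2 * N))
  calc M * (N : ℝ) ^ (-(3 / 2) : ℝ) * restBound g s e N
      ≤ M * (2 ^ (3 / 2 : ℝ) * ((N + 1 : ℕ) : ℝ) ^ (-(3 / 2) : ℝ)) * restBound g s e N := by gcongr
    _ = M * 2 ^ (3 / 2 : ℝ) / c * restBound g s e N *
        (c * ((N + 1 : ℕ) : ℝ) ^ (-(3 / 2) : ℝ)) := by field_simp
    _ ≤ _ := by gcongr

lemma sum_Icc_one_div_le (N : ℕ) : ∑ m ∈ Finset.Icc 1 N, 1 / (m : ℝ) ≤ 1 + Real.log N := by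
  have h := harmonic_le_one_add_log N
  rw [harmonic_eq_sum_Icc] at h
  push_cast at h
  simpa using h

lemma sum_Icc_one_div_sqrt_le (N : ℕ) : ∑ m ∈ Finset.Icc 1 N, 1 / √(m : ℝ) ≤ 2 * √N := by
  induction N with
  | zero => simp
  | succ N ih =>
    rw [Finset.sum_Icc_succ_top (by omega)]
    have h1 : 0 < √((N + 1 : ℕ) : ℝ) := Real.sqrt_pos.2 (by positivity)
    have h2 : √(N : ℝ) ≤ √((N + 1 : ℕ) : ℝ) := Real.sqrt_le_sqrt (by push_cast; linarith)
    have h3 := Real.mul_self_sqrt (Nat.cast_nonneg (α := ℝ) N)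
    have h4 := Real.mul_self_sqrt (Nat.cast_nonneg (α := ℝ) (N + 1))
    have h5 : 1 / √((N + 1 : ℕ) : ℝ) ≤ 2 * (√((N + 1 : ℕ) : ℝ) - √(N : ℝ)) := by
      rw [div_le_iff₀ h1]
      push_cast at *
      nlinarith [Real.sqrt_nonneg (N : ℝ)]
    linarith

lemma sum_Icc_rpow_le (N : ℕ) : ∑ m ∈ Finset.Icc 1 N, (m : ℝ) ^ (-(3 / 2) : ℝ) ≤ 6 := by
  have h : ∑ m ∈ Finset.Icc 1 N, (m : ℝ) ^ (-(3 / 2) : ℝ) ≤ 6 * (1 - 1 / √((N + 1 : ℕ) : ℝ)) := by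
    induction N with
    | zero => simp
    | succ N ih =>
      rw [Finset.sum_Icc_succ_top (by omega)]
      have := rpow_neg_three_halves_le (x := (N + 1 : ℕ)) (Nat.one_le_cast.2 (by omega))
      rw [show ((N + 1 + 1 : ℕ) : ℝ) = ((N + 1 : ℕ) : ℝ) + 1 by push_cast; ring]
      linarith
  have : 0 ≤ 1 / √((N + 1 : ℕ) : ℝ) := by positivity
  linarith

lemma restBound_cast_zero (N : ℕ) : restBound (fun m => (m : ℝ)) 0 1 N ≤ 3 * √N := by
  have h : ∑ m ∈ Finset.Icc 1 N, (m : ℝ) * (m : ℝ) ^ (-(3 / 2) : ℝ) * (1 / √m) ^ 0 =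
      ∑ m ∈ Finset.Icc 1 N, 1 / √(m : ℝ) := Finset.sum_congr rfl fun m hm => by
    have hm : (0 : ℝ) < m := by exact_mod_cast (Finset.mem_Icc.1 hm).1
    rw [rpow_neg_three_halves hm, pow_zero, mul_one]
    field_simp
  have h2 : (N : ℝ) * (1 / √N) ^ 1 = √N := by
    rw [pow_one, mul_one_div, Real.div_sqrt]
  rw [restBound, h, h2]
  linarith [sum_Icc_one_div_sqrt_le N]

lemma restBound_sqrt {N : ℕ} (hN : 0 < N) :
    restBound (fun m => √(m : ℝ)) 0 1 N ≤ 2 + Real.log N := by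
  have h : ∑ m ∈ Finset.Icc 1 N, √(m : ℝ) * (m : ℝ) ^ (-(3 / 2) : ℝ) * (1 / √m) ^ 0 =
      ∑ m ∈ Finset.Icc 1 N, 1 / (m : ℝ) := Finset.sum_congr rfl fun m hm => by
    have hm : (0 : ℝ) < m := by exact_mod_cast (Finset.mem_Icc.1 hm).1
    have := Real.sqrt_pos.2 hm
    rw [rpow_neg_three_halves hm, pow_zero, mul_one]
    field_simp
  have h2 : √(N : ℝ) * (1 / √N) ^ 1 = 1 := by
    rw [pow_one, mul_one_div_cancel (Real.sqrt_pos.2 (by exact_mod_cast hN)).ne']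
  rw [restBound, h, h2]
  linarith [sum_Icc_one_div_le N]

lemma restBound_cast_one {N : ℕ} (hN : 0 < N) :
    restBound (fun m => (m : ℝ)) 1 2 N ≤ 2 + Real.log N := by
  have h : ∑ m ∈ Finset.Icc 1 N, (m : ℝ) * (m : ℝ) ^ (-(3 / 2) : ℝ) * (1 / √m) ^ 1 =
      ∑ m ∈ Finset.Icc 1 N, 1 / (m : ℝ) := Finset.sum_congr rfl fun m hm => by
    have hm : (0 : ℝ) < m := by exact_mod_cast (Finset.mem_Icc.1 hm).1
    have h1 := Real.sqrt_pos.2 hm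
    have h2 := Real.sq_sqrt hm.le
    rw [rpow_neg_three_halves hm, pow_one]
    field_simp
    rw [h2]
  have hN' : (0 : ℝ) < N := by exact_mod_cast hN
  have h2 : (N : ℝ) * (1 / √N) ^ 2 = 1 := by
    rw [div_pow, one_pow, Real.sq_sqrt hN'.le, mul_one_div_cancel hN'.ne']
  rw [restBound, h, h2]
  linarith [sum_Icc_one_div_le N]

lemma restBound_cast_two {N : ℕ} (hN : 0 < N) : restBound (fun m => (m : ℝ)) 2 2 N ≤ 7 := by
  have h : ∑ m ∈ Finset.Icc 1 N, (m : ℝ) * (m : ℝ) ^ (-(3 / 2) : ℝ) * (1 / √m) ^ 2 =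
      ∑ m ∈ Finset.Icc 1 N, (m : ℝ) ^ (-(3 / 2) : ℝ) := Finset.sum_congr rfl fun m hm => by
    have hm : (0 : ℝ) < m := by exact_mod_cast (Finset.mem_Icc.1 hm).1
    rw [div_pow, one_pow, Real.sq_sqrt hm.le]
    field_simp
  have hN' : (0 : ℝ) < N := by exact_mod_cast hN
  have h2 : (N : ℝ) * (1 / √N) ^ 2 = 1 := by
    rw [div_pow, one_pow, Real.sq_sqrt hN'.le, mul_one_div_cancel hN'.ne']
  rw [restBound, h, h2]
  linarith [sum_Icc_rpow_le N]

namespace PTree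

/-- The tree whose root has the subtrees `u` followed by `r` leaves. -/
def graft {k : ℕ} (r : ℕ) (u : Fin k → PTree) : PTree :=
  node (List.ofFn u ++ List.replicate r (node []))

lemma graft_injective (k r : ℕ) : Function.Injective (graft (k := k) r) := fun u v h => by
  rw [graft, graft, node.injEq, List.append_cancel_right_eq] at h
  exact List.ofFn_injective h

lemma size_graft {k : ℕ} (r : ℕ) (u : Fin k → PTree) :
    (graft r u).size = 1 + (∑ i, (u i).size + r) := by
  rw [graft, size_node]
  simp [size_node, List.sum_ofFn, Function.comp_def]

lemma le_Nk_graft {k : ℕ} (r : ℕ) (u : Fin k → PTree) (hk : 0 < k) {x : ℕ}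
    (hx : ∀ i, x ≤ (u i).size) : x ≤ Nk k (graft r u) := by
  by_contra hlt
  have hperm : (sortedSizesDesc (graft r u)).Perm (childSizes (graft r u)) :=
    List.perm_insertionSort _ _
  have hsort : (sortedSizesDesc (graft r u)).Pairwise (· ≥ ·) := List.pairwise_insertionSort _ _
  have hcount : k ≤ (sortedSizesDesc (graft r u)).countP (x ≤ ·) := by
    rw [hperm.countP_eq, graft, childSizes, List.map_append, List.countP_append, List.map_ofFn]
    refine le_add_right (le_of_eq ?_)
    rw [List.countP_eq_length.2]
    · simp
    · intro a ha
      obtain ⟨i, rfl⟩ := List.mem_ofFn.1 ha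
      simpa using hx i
  rw [Nk] at hlt
  revert hsort hcount hlt
  generalize sortedSizesDesc (graft r u) = l
  intro hlt hsort hcount
  rw [← List.take_append_drop (k - 1) l, List.countP_append] at hcount
  have h1 : (l.take (k - 1)).countP (x ≤ ·) ≤ k - 1 :=
    List.countP_le_length.trans (List.length_take_le _ _)
  have h2 : (l.drop (k - 1)).countP (x ≤ ·) = 0 := by
    have hs : (l.drop (k - 1)).Pairwise (· ≥ ·) := hsort.drop
    rw [List.getD_eq_getElem?_getD, ← List.head?_drop] at hlt
    revert hs hlt
    generalize l.drop (k - 1) = l'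
    intro hlt hs
    cases l' with
    | nil => rfl
    | cons y l' =>
      rw [List.head?_cons, Option.getD_some] at hlt
      rw [List.countP_eq_zero]
      intro a ha
      rcases List.mem_cons.1 ha with rfl | ha
      · simpa using hlt
      · have := List.rel_of_pairwise_cons hs ha
        simp only [decide_eq_true_eq]
        omega
  omega

end PTree

lemma treeMass_graft {p : ℕ → ℝ} (hp : ∀ i, 0 ≤ p i) {k : ℕ} (r : ℕ) (u : Fin k → PTree) :
    treeMass p (PTree.graft r u) =
      ENNReal.ofReal (p (k + r) * p 0 ^ r) * ∏ i, treeMass p (u i) := by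
  rw [PTree.graft, treeMass_node hp, List.map_append, List.prod_append, List.map_ofFn,
    List.prod_ofFn, List.map_replicate, List.prod_replicate, treeMass_node hp,
    ENNReal.ofReal_mul (hp _), ENNReal.ofReal_pow (hp 0)]
  simp only [List.length_append, List.length_ofFn, List.length_replicate, List.length_nil,
    List.map_nil, List.prod_nil, mul_one, Function.comp_apply]
  ring

lemma tsum_prod_treeMass_mul_sizes (p : ℕ → ℝ) (k : ℕ) (Φ : (Fin k → ℕ) → ℝ≥0∞) :
    ∑' u : Fin k → PTree, (∏ i, treeMass p (u i)) * Φ (fun i => (u i).size) =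
      ∑' a : Fin k → ℕ, (∏ i, forestMass p 1 (a i)) * Φ a := by
  induction k with
  | zero =>
    rw [tsum_eq_single default (fun b hb => (hb (Subsingleton.elim _ _)).elim),
      tsum_eq_single default (fun b hb => (hb (Subsingleton.elim _ _)).elim)]
    simp only [Finset.univ_eq_empty, Finset.prod_empty, one_mul]
    congr 1
    exact Subsingleton.elim _ _
  | succ k ih =>
    rw [tsum_fin_succ, tsum_fin_succ]
    simp only [Fin.prod_univ_succ, Fin.cons_zero, Fin.cons_succ, mul_assoc, ENNReal.tsum_mul_left]
    rw [← tsum_treeMass_mul]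
    refine tsum_congr fun t => ?_
    rw [← ih fun b => Φ (Fin.cons t.size b)]
    congr 1
    refine tsum_congr fun v => ?_
    congr 2
    funext i
    refine Fin.cases ?_ (fun j => ?_) i <;> simp

lemma le_treeExp_Nk {p : ℕ → ℝ} (hp : ∀ i, 0 ≤ p i) {g : ℕ → ℝ} (hg : Monotone g) {k : ℕ}
    (hk : 0 < k) (r : ℕ) {ι : Type*} (S : Finset ι) (a : ι → Fin k → ℕ) (ha : Set.InjOn a S)
    (y : ι → ℕ) (hy : ∀ j ∈ S, ∀ i, y j ≤ a j i) {n : ℕ}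
    (hsum : ∀ j ∈ S, 1 + (∑ i, a j i + r) = n) :
    ENNReal.ofReal (p (k + r) * p 0 ^ r) *
        ∑ j ∈ S, (∏ i, forestMass p 1 (a j i)) * ENNReal.ofReal (g (y j)) ≤
      treeExp p n fun T => g (T.Nk k) := by
  classical
  have hfin : ∀ b : Fin k → ℕ, ∃ x, (∀ i, x ≤ b i) ∧ ∀ z, (∀ i, z ≤ b i) → z ≤ x := fun b => by
    have : Nonempty (Fin k) := ⟨⟨0, hk⟩⟩
    exact ⟨Finset.univ.inf' Finset.univ_nonempty b, fun i => Finset.inf'_le _ (Finset.mem_univ i),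
      fun z hz => Finset.le_inf' _ _ fun i _ => hz i⟩
  choose μ hμ hμ' using hfin
  let Φ : (Fin k → ℕ) → ℝ≥0∞ := fun b =>
    if 1 + (∑ i, b i + r) = n then ENNReal.ofReal (g (μ b)) else 0
  calc _ ≤ ENNReal.ofReal (p (k + r) * p 0 ^ r) *
        ∑ b ∈ S.image a, (∏ i, forestMass p 1 (b i)) * Φ b := by
        rw [Finset.sum_image ha]
        gcongr with j hj
        simp only [Φ]
        rw [if_pos (hsum j hj)]
        exact ENNReal.ofReal_le_ofReal (hg (hμ' _ _ (hy j hj)))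
    _ ≤ ENNReal.ofReal (p (k + r) * p 0 ^ r) *
        ∑' u : Fin k → PTree, (∏ i, treeMass p (u i)) * Φ (fun i => (u i).size) := by
        rw [tsum_prod_treeMass_mul_sizes]
        gcongr
        exact ENNReal.sum_le_tsum _
    _ ≤ ∑' u : Fin k → PTree, treeMass p (PTree.graft r u) *
          if (PTree.graft r u).size = n then
            ENNReal.ofReal (g ((PTree.graft r u).Nk k)) else 0 := by
        rw [← ENNReal.tsum_mul_left]
        refine ENNReal.tsum_le_tsum fun u => ?_
        rw [treeMass_graft hp, mul_assoc]
        gcongr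
        simp only [Φ, PTree.size_graft]
        split_ifs
        · exact ENNReal.ofReal_le_ofReal (hg (PTree.le_Nk_graft r u hk (hμ _)))
        · exact le_rfl
    _ ≤ _ := ENNReal.tsum_comp_le_tsum_of_injective (PTree.graft_injective k r) fun T =>
        treeMass p T * if T.size = n then ENNReal.ofReal (g (T.Nk k)) else 0

/-- A lower bound for the expectation of `g (N_k)` by a sum over possible profiles of the `k`
largest subtrees of the root. -/
lemma exists_le_condExp_Nk {p : ℕ → ℝ} (hp : IsCriticalLaw p) {k d : ℕ} (hk : 0 < k)
    (hkd : k ≤ d) (hd : 0 < p d) :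
    ∃ c : ℝ, 0 < c ∧ ∃ X A n₀ : ℕ, 0 < X ∧ 0 < A ∧ ∀ n : ℕ, n₀ ≤ n → n ∈ gwSupport p →
      ∃ Q : ℕ, n ≤ A * Q ∧ Q ≤ n ∧ ∀ g : ℕ → ℝ, Monotone g → (∀ m, 0 ≤ g m) →
        treeExp p n (fun T => g (T.Nk k)) ≠ ⊤ → ∀ (S : Finset (Fin k → ℕ)) (y : (Fin k → ℕ) → ℕ),
        (∀ x ∈ S, ∑ i, x i = Q ∧ ∀ i, X ≤ x i ∧ y x ≤ x i) →
        c * (n : ℝ) ^ (3 / 2 : ℝ) * ∑ x ∈ S, (∏ i, (x i : ℝ) ^ (-(3 / 2) : ℝ)) * g (y x) ≤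
          condExp p n fun T => g (T.Nk k) := by
  obtain ⟨h, hh, hdvd, hdvd', c, hc, m₀, hle⟩ := exists_le_forestMass_one hp
  obtain ⟨K, hK, hsumle⟩ := exists_treeSum_le hp
  obtain ⟨r, rfl⟩ := Nat.exists_eq_add_of_le hkd
  have hp0 := hp.zero_pos
  have hw : (0 : ℝ) < p (k + r) * p 0 ^ r := by positivity
  have hh' : (0 : ℝ) < h := by exact_mod_cast hh
  have hc' : 0 < c * (2 * h) ^ (-(3 / 2) : ℝ) := by positivity
  refine ⟨p (k + r) * p 0 ^ r * (c * (2 * h) ^ (-(3 / 2) : ℝ)) ^ k / K, by positivity, m₀ + 1,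
    h + 1 + (k + r), h + 1 + (k + r), by omega, by omega, fun n hn hmem => ?_⟩
  obtain ⟨n, rfl⟩ : ∃ m, n = m + 1 := ⟨n - 1, by omega⟩
  obtain ⟨Q, hQ⟩ : h ∣ n - (k + r) := Nat.dvd_sub
    (hdvd' n (forestMass_one_ne_zero hp.nonneg hmem)) (hdvd (k + r) hd.ne')
  have hnQ : n = k + r + h * Q := by omega
  have hQ1 : 1 ≤ Q := by
    by_contra h0
    obtain rfl : Q = 0 := by omega
    omega
  refine ⟨Q, ?_, ?_, fun g hg hgnn hfin S y hS => ?_⟩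
  · rw [hnQ]
    nlinarith
  · nlinarith
  have hmass : ∀ x : ℕ, m₀ + 1 ≤ x →
      ENNReal.ofReal (c * (2 * h) ^ (-(3 / 2) : ℝ) * (x : ℝ) ^ (-(3 / 2) : ℝ)) ≤
        forestMass p 1 (h * x + 1) := by
    intro x hx
    refine le_trans (ENNReal.ofReal_le_ofReal ?_) (hle (h * x) (by nlinarith) (dvd_mul_right h x))
    rw [mul_assoc, ← Real.mul_rpow (by positivity) (by positivity)]
    refine mul_le_mul_of_nonneg_left
      (Real.rpow_le_rpow_of_nonpos (by positivity) ?_ (by norm_num)) hc.le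
    have : h * x + 1 ≤ 2 * h * x := by nlinarith
    exact_mod_cast this
  have hinj : Set.InjOn (fun (x : Fin k → ℕ) i => h * x i + 1) S := fun x _ x' _ hxx => by
    funext i
    have := congrFun hxx i
    simp only [Nat.add_right_cancel_iff] at this
    exact Nat.eq_of_mul_eq_mul_left hh this
  have hmain := le_treeExp_Nk hp.nonneg hg hk r S (fun x i => h * x i + 1) hinj y
    (n := n + 1) (fun x hx i => ((hS x hx).2 i).2.trans (by nlinarith)) fun x hx => by
      rw [Finset.sum_add_distrib, ← Finset.mul_sum, (hS x hx).1, hnQ]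
      simp
      ring
  have hlow : ENNReal.ofReal (p (k + r) * p 0 ^ r * (c * (2 * h) ^ (-(3 / 2) : ℝ)) ^ k *
      ∑ x ∈ S, (∏ i, (x i : ℝ) ^ (-(3 / 2) : ℝ)) * g (y x)) ≤
      treeExp p (n + 1) fun T => g (T.Nk k) := by
    refine le_trans ?_ hmain
    rw [mul_assoc, ENNReal.ofReal_mul hw.le, Finset.mul_sum, ENNReal.ofReal_sum_of_nonneg]
    swap
    · intro x _
      have := hgnn (y x)
      positivity
    gcongr with x hx
    rw [← mul_assoc, ENNReal.ofReal_mul (by positivity)]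
    gcongr
    rw [← Fin.prod_const, ← Finset.prod_mul_distrib, ENNReal.ofReal_prod_of_nonneg]
    · exact Finset.prod_le_prod' fun i _ => hmass _ ((hS x hx).2 i).1
    · intro i _
      positivity
  have ha : 0 < p (k + r) * p 0 ^ r * (c * (2 * h) ^ (-(3 / 2) : ℝ)) ^ k := by positivity
  rw [condExp_eq hp.nonneg _ fun T => hgnn _, le_div_iff₀ hmem.2]
  refine le_trans ?_ ((ENNReal.ofReal_le_iff_le_toReal hfin).1 hlow)
  have hR : 0 ≤ ∑ x ∈ S, (∏ i, (x i : ℝ) ^ (-(3 / 2) : ℝ)) * g (y x) :=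
    Finset.sum_nonneg fun x _ => by
      have := hgnn (y x)
      positivity
  have hn1 : (0 : ℝ) < (n + 1 : ℕ) := by positivity
  have hpow : ((n + 1 : ℕ) : ℝ) ^ (3 / 2 : ℝ) * ((n + 1 : ℕ) : ℝ) ^ (-(3 / 2) : ℝ) = 1 := by
    rw [← Real.rpow_add hn1]
    norm_num
  have hs := hsumle (n + 1) n.succ_pos
  generalize ∑ x ∈ S, (∏ i, (x i : ℝ) ^ (-(3 / 2) : ℝ)) * g (y x) = R at *
  generalize p (k + r) * p 0 ^ r * (c * (2 * h) ^ (-(3 / 2) : ℝ)) ^ k = a at *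
  calc a / K * ((n + 1 : ℕ) : ℝ) ^ (3 / 2 : ℝ) * R * treeSum p (n + 1)
      ≤ a / K * ((n + 1 : ℕ) : ℝ) ^ (3 / 2 : ℝ) * R *
          (K * ((n + 1 : ℕ) : ℝ) ^ (-(3 / 2) : ℝ)) := by gcongr
    _ = a * R * (((n + 1 : ℕ) : ℝ) ^ (3 / 2 : ℝ) * ((n + 1 : ℕ) : ℝ) ^ (-(3 / 2) : ℝ)) := by
        field_simp
    _ = a * R := by rw [hpow, mul_one]

lemma one_le_rpow_mul_rpow_neg {a b r : ℝ} (hr : 0 ≤ r) (ha : 0 < a) (hab : a ≤ b) :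
    1 ≤ b ^ r * a ^ (-r) := by
  rw [Real.rpow_neg ha.le, ← div_eq_mul_inv, one_le_div (by positivity)]
  exact Real.rpow_le_rpow ha.le hab hr

lemma div_eight_mul_le {n A Q : ℕ} (h : n ≤ A * Q) : n / (8 * A) ≤ Q / 8 := by
  rw [mul_comm, ← Nat.div_div_eq_div_mul]
  exact Nat.div_le_div_right (Nat.div_le_of_le_mul h)

lemma exists_le_condExp_Nk_two {p : ℕ → ℝ} (hp : IsCriticalLaw p) :
    ∃ c : ℝ, 0 < c ∧ ∃ X B n₀ : ℕ, 0 < X ∧ 0 < B ∧ ∀ n : ℕ, n₀ ≤ n → n ∈ gwSupport p →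
      ∀ g : ℕ → ℝ, Monotone g → (∀ m, 0 ≤ g m) → treeExp p n (fun T => g (T.Nk 2)) ≠ ⊤ →
        c * ∑ j ∈ Finset.Icc X (n / B), (j : ℝ) ^ (-(3 / 2) : ℝ) * g j ≤
          condExp p n fun T => g (T.Nk 2) := by
  obtain ⟨d, hd, hpd⟩ := hp.exists_two_le
  obtain ⟨c, hc, X, A, n₀, hX, hA, hle⟩ := exists_le_condExp_Nk hp two_pos hd hpd
  refine ⟨c, hc, X, 8 * A, n₀ + 1, hX, by omega, fun n hn hmem g hg hgnn hfin => ?_⟩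
  obtain ⟨Q, hnQ, hQn, hQ⟩ := hle n (by omega) hmem
  have hM := div_eight_mul_le hnQ
  generalize n / (8 * A) = M at *
  let x : ℕ → Fin 2 → ℕ := fun j => ![Q - j, j]
  have hx : Function.Injective x := fun j j' h => by simpa [x] using congrFun h 1
  refine le_trans ?_ (hQ g hg hgnn hfin ((Finset.Icc X M).image x) (fun z => z 1) ?_)
  swap
  · intro z hz
    obtain ⟨j, hj, rfl⟩ := Finset.mem_image.1 hz
    rw [Finset.mem_Icc] at hj
    simp only [x, Fin.sum_univ_two, Fin.forall_fin_two, Matrix.cons_val_zero, Matrix.cons_val_one]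
    omega
  rw [mul_assoc, Finset.sum_image hx.injOn]
  refine mul_le_mul_of_nonneg_left ?_ hc.le
  rw [Finset.mul_sum]
  refine Finset.sum_le_sum fun j hj => ?_
  rw [Finset.mem_Icc] at hj
  simp only [x, Fin.prod_univ_two, Matrix.cons_val_zero, Matrix.cons_val_one]
  have h1 := one_le_rpow_mul_rpow_neg (r := 3 / 2) (a := (Q - j : ℕ)) (b := n) (by norm_num)
    (by exact_mod_cast (by omega : 0 < Q - j)) (by exact_mod_cast (by omega : Q - j ≤ n))
  have h2 : 0 ≤ (j : ℝ) ^ (-(3 / 2) : ℝ) * g j := mul_nonneg (by positivity) (hgnn j)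
  calc (j : ℝ) ^ (-(3 / 2) : ℝ) * g j ≤ _ := le_mul_of_one_le_left h2 h1
    _ = _ := by ring

lemma exists_le_condExp_Nk_three {p : ℕ → ℝ} (hp : IsCriticalLaw p) {d : ℕ} (hd : 3 ≤ d)
    (hpd : 0 < p d) :
    ∃ c : ℝ, 0 < c ∧ ∃ X B n₀ : ℕ, 0 < X ∧ 0 < B ∧ ∀ n : ℕ, n₀ ≤ n → n ∈ gwSupport p →
      treeExp p n (fun T => (T.Nk 3 : ℝ)) ≠ ⊤ →
        c * ∑ j ∈ Finset.Icc X (n / B), 1 / (j : ℝ) ≤ condExp p n fun T => (T.Nk 3 : ℝ) := by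
  obtain ⟨c, hc, X, A, n₀, hX, hA, hle⟩ := exists_le_condExp_Nk hp three_pos hd hpd
  refine ⟨c * 2 ^ (-(3 / 2) : ℝ), by positivity, X, 8 * A, n₀ + 1, hX, by omega,
    fun n hn hmem hfin => ?_⟩
  obtain ⟨Q, hnQ, hQn, hQ⟩ := hle n (by omega) hmem
  have hM := div_eight_mul_le hnQ
  generalize n / (8 * A) = M at *
  let x : (_ : ℕ) × ℕ → Fin 3 → ℕ := fun j => ![Q - (j.2 + j.1), j.2, j.1]
  have hx : Function.Injective x := fun j j' h =>
    Sigma.ext (by simpa [x] using congrFun h 2) (heq_of_eq (by simpa [x] using congrFun h 1))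
  refine le_trans ?_ (hQ (fun m => (m : ℝ)) Nat.mono_cast (fun m => m.cast_nonneg) hfin
    (((Finset.Icc X M).sigma fun j => Finset.Icc j (2 * j)).image x) (fun z => z 2) ?_)
  swap
  · intro z hz
    obtain ⟨j, hj, rfl⟩ := Finset.mem_image.1 hz
    simp only [Finset.mem_sigma, Finset.mem_Icc] at hj
    refine ⟨?_, fun i => ?_⟩
    · simp [x, Fin.sum_univ_three]
      omega
    · fin_cases i <;> simp [x] <;> omega
  rw [mul_assoc, mul_assoc, Finset.sum_image hx.injOn]
  refine mul_le_mul_of_nonneg_left ?_ hc.le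
  rw [Finset.sum_sigma, Finset.mul_sum, Finset.mul_sum]
  refine Finset.sum_le_sum fun j hj => ?_
  rw [Finset.mem_Icc] at hj
  have hj0 : (0 : ℝ) < j := by exact_mod_cast (by omega : 0 < j)
  have hterm : ∀ i ∈ Finset.Icc j (2 * j), (2 * j : ℝ) ^ (-(3 / 2) : ℝ) *
      ((j : ℝ) ^ (-(3 / 2) : ℝ) * j) ≤ (n : ℝ) ^ (3 / 2 : ℝ) *
        ((∏ k, (x ⟨j, i⟩ k : ℝ) ^ (-(3 / 2) : ℝ)) * (x ⟨j, i⟩ 2 : ℝ)) := by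
    intro i hi
    rw [Finset.mem_Icc] at hi
    have h1 := one_le_rpow_mul_rpow_neg (r := 3 / 2) (a := (Q - (i + j) : ℕ)) (b := n)
      (by norm_num) (by exact_mod_cast (by omega : 0 < Q - (i + j)))
      (by exact_mod_cast (by omega : Q - (i + j) ≤ n))
    have h2 : (2 * j : ℝ) ^ (-(3 / 2) : ℝ) ≤ (i : ℝ) ^ (-(3 / 2) : ℝ) :=
      Real.rpow_le_rpow_of_nonpos (by exact_mod_cast (by omega : 0 < i))
        (by exact_mod_cast hi.2) (by norm_num)
    simp only [x, Fin.prod_univ_three, Matrix.cons_val]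
    calc _ ≤ (i : ℝ) ^ (-(3 / 2) : ℝ) * ((j : ℝ) ^ (-(3 / 2) : ℝ) * j) := by gcongr
      _ ≤ _ := le_mul_of_one_le_left (by positivity) h1
      _ = _ := by ring
  rw [Finset.mul_sum]
  refine le_trans ?_ (Finset.sum_le_sum hterm)
  rw [Finset.sum_const, Nat.card_Icc, nsmul_eq_mul, Real.mul_rpow two_pos.le hj0.le,
    show 2 * j + 1 - j = j + 1 by omega]
  have h3 := Real.sq_sqrt hj0.le
  have h4 := Real.sqrt_pos.2 hj0
  calc 2 ^ (-(3 / 2) : ℝ) * (1 / (j : ℝ)) =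
        j * (2 ^ (-(3 / 2) : ℝ) * (j : ℝ) ^ (-(3 / 2) : ℝ) * ((j : ℝ) ^ (-(3 / 2) : ℝ) * j)) := by
        rw [rpow_neg_three_halves hj0]
        field_simp
        rw [h3]
    _ ≤ _ := by
        gcongr
        exact_mod_cast Nat.le_succ j

lemma exists_le_sum_one_div_sqrt {X B : ℕ} (hX : 0 < X) (hB : 0 < B) :
    ∃ c : ℝ, 0 < c ∧ ∃ n₀ : ℕ, ∀ n : ℕ, n₀ ≤ n →
      c * √n ≤ ∑ j ∈ Finset.Icc X (n / B), 1 / √(j : ℝ) := by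
  have hB' : (0 : ℝ) < B := by exact_mod_cast hB
  refine ⟨1 / (2 * B), by positivity, B * (2 * X) + 1, fun n hn => ?_⟩
  have hn0 : (0 : ℝ) < n := by exact_mod_cast (by omega : 0 < n)
  have hM : 2 * X ≤ n / B := (Nat.le_div_iff_mul_le hB).2 (by rw [mul_comm]; omega)
  have hM' : (n : ℝ) < B * (n / B + 1 : ℕ) := by
    exact_mod_cast Nat.lt_mul_div_succ n hB
  have hMn : n / B ≤ n := Nat.div_le_self n B
  generalize n / B = M at *
  calc 1 / (2 * B) * √(n : ℝ) = n / (2 * B) * (1 / √n) := by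
        have h1 := Real.sqrt_pos.2 hn0
        field_simp
        rw [Real.sq_sqrt hn0.le]
    _ ≤ (M + 1 - X : ℕ) * (1 / √n) := by
        gcongr
        rw [div_le_iff₀ (by positivity)]
        have h1 : ((M + 1 : ℕ) : ℝ) ≤ 2 * (M + 1 - X : ℕ) := by
          exact_mod_cast (by omega : M + 1 ≤ 2 * (M + 1 - X))
        nlinarith
    _ = ∑ _j ∈ Finset.Icc X M, 1 / √(n : ℝ) := by
        rw [Finset.sum_const, Nat.card_Icc, nsmul_eq_mul]
    _ ≤ _ := by
        refine Finset.sum_le_sum fun j hj => ?_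
        rw [Finset.mem_Icc] at hj
        have hj0 : (0 : ℝ) < √j := Real.sqrt_pos.2 (by exact_mod_cast (by omega : 0 < j))
        gcongr
        omega

lemma exists_le_sum_one_div (X : ℕ) {B : ℕ} (hB : 0 < B) :
    ∃ c : ℝ, 0 < c ∧ ∃ n₀ : ℕ, ∀ n : ℕ, n₀ ≤ n →
      c * Real.log n ≤ ∑ j ∈ Finset.Icc X (n / B), 1 / (j : ℝ) := by
  have hB' : (0 : ℝ) < B := by exact_mod_cast hB
  obtain ⟨n₀, hn₀⟩ := Filter.eventually_atTop.1
    ((Real.tendsto_log_atTop.comp tendsto_natCast_atTop_atTop).eventually_ge_atTop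
      (2 * (Real.log B + X)))
  refine ⟨1 / 2, by norm_num, n₀ + 1, fun n hn => ?_⟩
  have hlog := hn₀ n (by omega)
  have hn0 : (0 : ℝ) < n := by exact_mod_cast (by omega : 0 < n)
  have hM' : (n : ℝ) ≤ B * (n / B + 1 : ℕ) := by
    exact_mod_cast (Nat.lt_mul_div_succ n hB).le
  generalize n / B = M at *
  have h1 := log_add_one_le_harmonic M
  rw [harmonic_eq_sum_Icc] at h1
  have h2 : Real.log n ≤ Real.log B + Real.log ((M + 1 : ℕ) : ℝ) := by
    rw [← Real.log_mul hB'.ne' (by positivity)]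
    exact Real.log_le_log hn0 hM'
  have h3 : ∑ j ∈ Finset.Icc 1 M, 1 / (j : ℝ) ≤
      X + ∑ j ∈ Finset.Icc X M, 1 / (j : ℝ) := by
    calc _ ≤ ∑ j ∈ Finset.range X ∪ Finset.Icc X M, 1 / (j : ℝ) := by
          refine Finset.sum_le_sum_of_subset_of_nonneg (fun j hj => ?_) fun _ _ _ => by positivity
          simp only [Finset.mem_union, Finset.mem_range, Finset.mem_Icc] at hj ⊢
          omega
      _ ≤ ∑ j ∈ Finset.range X, 1 / (j : ℝ) + ∑ j ∈ Finset.Icc X M, 1 / (j : ℝ) := by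
          rw [← Finset.sum_union_inter]
          exact le_add_of_nonneg_right (Finset.sum_nonneg fun _ _ => by positivity)
      _ ≤ _ := by
          gcongr
          calc _ ≤ ∑ j ∈ Finset.range X, (1 : ℝ) := by
                refine Finset.sum_le_sum fun j _ => ?_
                rcases Nat.eq_zero_or_pos j with rfl | hj
                · simp
                · rw [div_le_one (by exact_mod_cast hj)]
                  exact Nat.one_le_cast.2 hj
            _ = X := by simp
  push_cast at h1 h2
  simp only [Function.comp_apply] at hlog
  simp only [one_div] at h3 ⊢
  linarith

lemma MomentFinite.summable_pow {p : ℕ → ℝ} (hp : ∀ i, 0 ≤ p i) {r : ℝ} (h : MomentFinite p r)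
    {k : ℕ} (hk : k ≠ 0) (hkr : (k : ℝ) ≤ r) : Summable fun i : ℕ => (i : ℝ) ^ k * p i := by
  refine Summable.of_nonneg_of_le (fun i => mul_nonneg (by positivity) (hp i)) (fun i => ?_) h
  refine mul_le_mul_of_nonneg_right ?_ (hp i)
  rcases Nat.eq_zero_or_pos i with rfl | hi
  · rw [Nat.cast_zero, zero_pow hk]
    positivity
  · rw [← Real.rpow_natCast]
    exact Real.rpow_le_rpow_of_exponent_le (Nat.one_le_cast.2 hi) hkr

lemma log_pred_le {n : ℕ} (hn : 3 ≤ n) : 2 + Real.log ((n - 1 : ℕ) : ℝ) ≤ 3 * Real.log n := by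
  have h1 : Real.log ((n - 1 : ℕ) : ℝ) ≤ Real.log n :=
    Real.log_le_log (by exact_mod_cast (by omega : 0 < n - 1)) (by exact_mod_cast Nat.sub_le n 1)
  have h2 : 1 ≤ Real.log n := by
    rw [Real.le_log_iff_exp_le (by exact_mod_cast (by omega : 0 < n))]
    have h3 : (3 : ℝ) ≤ n := by exact_mod_cast hn
    linarith [Real.exp_one_lt_d9]
  linarith

lemma exists_condExp_le_sqrt {p : ℕ → ℝ} (hp : IsCriticalLaw p)
    (hmom : Summable fun i : ℕ => (i : ℝ) ^ 3 * p i) :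
    ∃ C : ℝ, 0 < C ∧ ∃ n₀ : ℕ, ∀ φ : PTree → ℝ, (∀ T, 0 ≤ φ T) →
      (∀ T, φ T ≤ (T.NkPlus 2 : ℝ)) → ∀ n : ℕ, n₀ ≤ n → n ∈ gwSupport p →
      condExp p n φ ≤ C * √n ∧ treeExp p n φ ≠ ⊤ := by
  obtain ⟨C, hC, n₀, h⟩ :=
    exists_condExp_le hp (s := 0) (e := 1) (by norm_num) (by norm_num) le_rfl hmom
  refine ⟨C * 3, by positivity, n₀, fun φ hφ hφg n hn hmem => ?_⟩
  obtain ⟨h1, h2⟩ := h (fun m => (m : ℝ)) Nat.mono_cast Nat.cast_zero φ hφ hφg n hn hmem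
  refine ⟨h1.trans ?_, h2⟩
  rw [mul_assoc]
  refine mul_le_mul_of_nonneg_left ((restBound_cast_zero _).trans ?_) hC.le
  gcongr
  exact Nat.sub_le n 1

lemma exists_condExp_le_log_of_le_sqrt {p : ℕ → ℝ} (hp : IsCriticalLaw p)
    (hmom : Summable fun i : ℕ => (i : ℝ) ^ 3 * p i) :
    ∃ C : ℝ, 0 < C ∧ ∃ n₀ : ℕ, ∀ φ : PTree → ℝ, (∀ T, 0 ≤ φ T) →
      (∀ T, φ T ≤ √(T.NkPlus 2 : ℝ)) → ∀ n : ℕ, n₀ ≤ n → n ∈ gwSupport p →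
      condExp p n φ ≤ C * Real.log n ∧ treeExp p n φ ≠ ⊤ := by
  obtain ⟨C, hC, n₀, h⟩ :=
    exists_condExp_le hp (s := 0) (e := 1) (by norm_num) (by norm_num) le_rfl hmom
  refine ⟨C * 3, by positivity, n₀ + 3, fun φ hφ hφg n hn hmem => ?_⟩
  obtain ⟨h1, h2⟩ := h (fun m => √(m : ℝ)) (fun a b hab => Real.sqrt_le_sqrt (Nat.cast_le.2 hab))
    (by simp) φ hφ hφg n (by omega) hmem
  refine ⟨h1.trans ?_, h2⟩
  rw [mul_assoc]
  exact mul_le_mul_of_nonneg_left ((restBound_sqrt (by omega)).trans (log_pred_le (by omega))) hC.le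

lemma exists_condExp_le_log {p : ℕ → ℝ} (hp : IsCriticalLaw p)
    (hmom : Summable fun i : ℕ => (i : ℝ) ^ 4 * p i) :
    ∃ C : ℝ, 0 < C ∧ ∃ n₀ : ℕ, ∀ φ : PTree → ℝ, (∀ T, 0 ≤ φ T) →
      (∀ T, φ T ≤ (T.NkPlus 3 : ℝ)) → ∀ n : ℕ, n₀ ≤ n → n ∈ gwSupport p →
      condExp p n φ ≤ C * Real.log n ∧ treeExp p n φ ≠ ⊤ := by
  obtain ⟨C, hC, n₀, h⟩ :=
    exists_condExp_le hp (s := 1) (e := 2) (by norm_num) le_rfl le_rfl hmom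
  refine ⟨C * 3, by positivity, n₀ + 3, fun φ hφ hφg n hn hmem => ?_⟩
  obtain ⟨h1, h2⟩ := h (fun m => (m : ℝ)) Nat.mono_cast Nat.cast_zero φ hφ hφg n (by omega) hmem
  refine ⟨h1.trans ?_, h2⟩
  rw [mul_assoc]
  exact mul_le_mul_of_nonneg_left ((restBound_cast_one (by omega)).trans (log_pred_le (by omega)))
    hC.le

lemma exists_condExp_le_const {p : ℕ → ℝ} (hp : IsCriticalLaw p)
    (hmom : Summable fun i : ℕ => (i : ℝ) ^ 5 * p i) :
    ∃ C : ℝ, 0 < C ∧ ∃ n₀ : ℕ, ∀ φ : PTree → ℝ, (∀ T, 0 ≤ φ T) →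
      (∀ T, φ T ≤ (T.NkPlus 4 : ℝ)) → ∀ n : ℕ, n₀ ≤ n → n ∈ gwSupport p →
      condExp p n φ ≤ C := by
  obtain ⟨C, hC, n₀, h⟩ :=
    exists_condExp_le hp (s := 2) (e := 2) le_rfl le_rfl (by norm_num) hmom
  refine ⟨C * 7, by positivity, n₀ + 2, fun φ hφ hφg n hn hmem => ?_⟩
  obtain ⟨h1, -⟩ := h (fun m => (m : ℝ)) Nat.mono_cast Nat.cast_zero φ hφ hφg n (by omega) hmem
  exact h1.trans (mul_le_mul_of_nonneg_left (restBound_cast_two (by omega)) hC.le)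

lemma condExp_mono {p : ℕ → ℝ} (hp : ∀ i, 0 ≤ p i) {n : ℕ} {φ ψ : PTree → ℝ} (hφ : ∀ T, 0 ≤ φ T)
    (h : ∀ T, φ T ≤ ψ T) (hfin : treeExp p n ψ ≠ ⊤) (hn : n ∈ gwSupport p) :
    condExp p n φ ≤ condExp p n ψ := by
  rw [condExp_eq hp n hφ, condExp_eq hp n fun T => (hφ T).trans (h T)]
  exact div_le_div_of_nonneg_right (ENNReal.toReal_mono hfin (treeExp_mono p n h)) hn.2.le

lemma exists_sqrt_le_condExp_Nk_two {p : ℕ → ℝ} (hp : IsCriticalLaw p) :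
    ∃ c : ℝ, 0 < c ∧ ∃ n₀ : ℕ, ∀ n : ℕ, n₀ ≤ n → n ∈ gwSupport p →
      treeExp p n (fun T => (T.Nk 2 : ℝ)) ≠ ⊤ →
        c * √n ≤ condExp p n fun T => (T.Nk 2 : ℝ) := by
  obtain ⟨c, hc, X, B, n₀, hX, hB, h⟩ := exists_le_condExp_Nk_two hp
  obtain ⟨c', hc', n₁, h'⟩ := exists_le_sum_one_div_sqrt hX hB
  refine ⟨c * c', by positivity, max n₀ n₁, fun n hn hmem hfin => ?_⟩
  rw [max_le_iff] at hn
  refine le_trans ?_ (h n hn.1 hmem (fun m => (m : ℝ)) Nat.mono_cast (fun m => m.cast_nonneg) hfin)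
  rw [mul_assoc]
  refine mul_le_mul_of_nonneg_left ((h' n hn.2).trans_eq (Finset.sum_congr rfl fun j hj => ?_))
    hc.le
  have hj : (0 : ℝ) < j := by exact_mod_cast hX.trans_le (Finset.mem_Icc.1 hj).1
  rw [rpow_neg_three_halves hj]
  field_simp

lemma exists_log_le_condExp_sqrt_Nk_two {p : ℕ → ℝ} (hp : IsCriticalLaw p) :
    ∃ c : ℝ, 0 < c ∧ ∃ n₀ : ℕ, ∀ n : ℕ, n₀ ≤ n → n ∈ gwSupport p →
      treeExp p n (fun T => √(T.Nk 2 : ℝ)) ≠ ⊤ →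
        c * Real.log n ≤ condExp p n fun T => √(T.Nk 2 : ℝ) := by
  obtain ⟨c, hc, X, B, n₀, hX, hB, h⟩ := exists_le_condExp_Nk_two hp
  obtain ⟨c', hc', n₁, h'⟩ := exists_le_sum_one_div X hB
  refine ⟨c * c', by positivity, max n₀ n₁, fun n hn hmem hfin => ?_⟩
  rw [max_le_iff] at hn
  refine le_trans ?_ (h n hn.1 hmem (fun m => √(m : ℝ))
    (fun a b hab => Real.sqrt_le_sqrt (Nat.cast_le.2 hab)) (fun m => Real.sqrt_nonneg _) hfin)
  rw [mul_assoc]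
  refine mul_le_mul_of_nonneg_left ((h' n hn.2).trans_eq (Finset.sum_congr rfl fun j hj => ?_))
    hc.le
  have hj : (0 : ℝ) < j := by exact_mod_cast hX.trans_le (Finset.mem_Icc.1 hj).1
  have := Real.sqrt_pos.2 hj
  rw [rpow_neg_three_halves hj]
  field_simp

lemma exists_log_le_condExp_Nk_three {p : ℕ → ℝ} (hp : IsCriticalLaw p)
    (hpos : 0 < ∑' l : ℕ, if 3 ≤ l then p l else 0) :
    ∃ c : ℝ, 0 < c ∧ ∃ n₀ : ℕ, ∀ n : ℕ, n₀ ≤ n → n ∈ gwSupport p →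
      treeExp p n (fun T => (T.Nk 3 : ℝ)) ≠ ⊤ →
        c * Real.log n ≤ condExp p n fun T => (T.Nk 3 : ℝ) := by
  obtain ⟨d, hd, hpd⟩ : ∃ d, 3 ≤ d ∧ 0 < p d := by
    by_contra! hcon
    refine hpos.not_ge (tsum_nonpos fun l => ?_)
    split_ifs with hl
    · exact hcon l hl
    · exact le_rfl
  obtain ⟨c, hc, X, B, n₀, hX, hB, h⟩ := exists_le_condExp_Nk_three hp hd hpd
  obtain ⟨c', hc', n₁, h'⟩ := exists_le_sum_one_div X hB
  refine ⟨c * c', by positivity, max n₀ n₁, fun n hn hmem hfin => ?_⟩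
  rw [max_le_iff] at hn
  refine le_trans ?_ (h n hn.1 hmem hfin)
  rw [mul_assoc]
  exact mul_le_mul_of_nonneg_left (h' n hn.2) hc.le

/-- asymptotics of the expectations of `N_k` and `N_{k+}` at the root
of `τ_n`, as `n → ∞` along `n ∈ I`. -/
theorem stmt_8 (p : ℕ → ℝ)
    (hp_nonneg : ∀ i, 0 ≤ p i)
    (hp_sum : ∑' i : ℕ, p i = 1)
    (hp_mean : ∑' i : ℕ, (i : ℝ) * p i = 1)
    (hp_sq : Summable (fun i : ℕ => (i : ℝ) ^ 2 * p i))
    (hp_var : 1 < ∑' i : ℕ, (i : ℝ) ^ 2 * p i) :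
    -- (i)
    (MomentFinite p 3 →
      (∃ c C : ℝ, ∃ n₀ : ℕ, 0 < c ∧ 0 < C ∧ ∀ n : ℕ, n₀ ≤ n → n ∈ gwSupport p →
        c * Real.sqrt n ≤ condExp p n (fun T => (PTree.Nk 2 T : ℝ)) ∧
          condExp p n (fun T => (PTree.Nk 2 T : ℝ)) ≤ C * Real.sqrt n)
      ∧ (∃ c C : ℝ, ∃ n₀ : ℕ, 0 < c ∧ 0 < C ∧ ∀ n : ℕ, n₀ ≤ n → n ∈ gwSupport p →
          c * Real.log n ≤ condExp p n (fun T => Real.sqrt (PTree.Nk 2 T : ℝ)) ∧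
            condExp p n (fun T => Real.sqrt (PTree.Nk 2 T : ℝ)) ≤ C * Real.log n))
    -- (ii)
    ∧ (MomentFinite p ((7 : ℝ) / 2) →
        ∃ c C : ℝ, ∃ n₀ : ℕ, 0 < c ∧ 0 < C ∧ ∀ n : ℕ, n₀ ≤ n → n ∈ gwSupport p →
          c * Real.sqrt n ≤ condExp p n (fun T => (PTree.NkPlus 2 T : ℝ)) ∧
            condExp p n (fun T => (PTree.NkPlus 2 T : ℝ)) ≤ C * Real.sqrt n)
    -- (iii)
    ∧ (MomentFinite p 4 →
        ∃ C : ℝ, ∃ n₀ : ℕ, 0 < C ∧ ∀ n : ℕ, n₀ ≤ n → n ∈ gwSupport p →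
          condExp p n (fun T => (PTree.Nk 3 T : ℝ)) ≤ C * Real.log n)
    -- (iv)
    ∧ (MomentFinite p 5 →
        (∃ C : ℝ, ∃ n₀ : ℕ, 0 < C ∧ ∀ n : ℕ, n₀ ≤ n → n ∈ gwSupport p →
          condExp p n (fun T => (PTree.NkPlus 3 T : ℝ)) ≤ C * Real.log n)
        ∧ (∃ C : ℝ, ∃ n₀ : ℕ, 0 < C ∧ ∀ n : ℕ, n₀ ≤ n → n ∈ gwSupport p →
            condExp p n (fun T => (PTree.Nk 4 T : ℝ)) ≤ C))
    -- (v)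
    ∧ (MomentFinite p ((13 : ℝ) / 2) →
        ∃ C : ℝ, ∃ n₀ : ℕ, 0 < C ∧ ∀ n : ℕ, n₀ ≤ n → n ∈ gwSupport p →
          condExp p n (fun T => (PTree.NkPlus 4 T : ℝ)) ≤ C)
    -- (iii) improved to Θ
    ∧ (MomentFinite p 4 → (0 < ∑' ℓ : ℕ, if 3 ≤ ℓ then p ℓ else 0) →
        ∃ c C : ℝ, ∃ n₀ : ℕ, 0 < c ∧ 0 < C ∧ ∀ n : ℕ, n₀ ≤ n → n ∈ gwSupport p →
          c * Real.log n ≤ condExp p n (fun T => (PTree.Nk 3 T : ℝ)) ∧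
            condExp p n (fun T => (PTree.Nk 3 T : ℝ)) ≤ C * Real.log n) := by
  have hasSum_one : ∀ {f : ℕ → ℝ}, ∑' i, f i = 1 → HasSum f 1 := fun {f} h => by
    refine h ▸ Summable.hasSum (by_contra fun hf => ?_)
    rw [tsum_eq_zero_of_not_summable hf] at h
    exact zero_ne_one h
  have hp : IsCriticalLaw p :=
    { nonneg := hp_nonneg
      hasSum := hasSum_one hp_sum
      hasSum_mean := hasSum_one hp_mean
      summable_sq := hp_sq
      one_lt_sq := hp_var }
  have hmom : ∀ {r : ℝ} {k : ℕ}, MomentFinite p r → k ≠ 0 → (k : ℝ) ≤ r →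
      Summable fun i : ℕ => (i : ℝ) ^ k * p i := fun h hk hkr => h.summable_pow hp_nonneg hk hkr
  have hle : ∀ k T, (PTree.Nk k T : ℝ) ≤ PTree.NkPlus k T := fun k T =>
    Nat.cast_le.2 (PTree.Nk_le_NkPlus k T)
  refine ⟨fun h => ⟨?_, ?_⟩, fun h => ?_, fun h => ?_, fun h => ⟨?_, ?_⟩, fun h => ?_,
    fun h hpos => ?_⟩
  · obtain ⟨C, hC, n₀, hu⟩ := exists_condExp_le_sqrt hp (hmom h (by norm_num) (by norm_num))
    obtain ⟨c, hc, n₁, hl⟩ := exists_sqrt_le_condExp_Nk_two hp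
    refine ⟨c, C, max n₀ n₁, hc, hC, fun n hn hmem => ?_⟩
    rw [max_le_iff] at hn
    have := hu _ (fun T => Nat.cast_nonneg _) (hle 2) n hn.1 hmem
    exact ⟨hl n hn.2 hmem this.2, this.1⟩
  · obtain ⟨C, hC, n₀, hu⟩ :=
      exists_condExp_le_log_of_le_sqrt hp (hmom h (by norm_num) (by norm_num))
    obtain ⟨c, hc, n₁, hl⟩ := exists_log_le_condExp_sqrt_Nk_two hp
    refine ⟨c, C, max n₀ n₁, hc, hC, fun n hn hmem => ?_⟩
    rw [max_le_iff] at hn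
    have := hu _ (fun T => Real.sqrt_nonneg _) (fun T => Real.sqrt_le_sqrt (hle 2 T)) n hn.1 hmem
    exact ⟨hl n hn.2 hmem this.2, this.1⟩
  · obtain ⟨C, hC, n₀, hu⟩ := exists_condExp_le_sqrt hp (hmom h (by norm_num) (by norm_num))
    obtain ⟨c, hc, n₁, hl⟩ := exists_sqrt_le_condExp_Nk_two hp
    refine ⟨c, C, max n₀ n₁, hc, hC, fun n hn hmem => ?_⟩
    rw [max_le_iff] at hn
    have h1 := hu _ (fun T => Nat.cast_nonneg _) (hle 2) n hn.1 hmem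
    have h2 := hu _ (fun T => Nat.cast_nonneg _) (fun T => le_rfl) n hn.1 hmem
    exact ⟨(hl n hn.2 hmem h1.2).trans
      (condExp_mono hp_nonneg (fun T => Nat.cast_nonneg _) (hle 2) h2.2 hmem), h2.1⟩
  · obtain ⟨C, hC, n₀, hu⟩ := exists_condExp_le_log hp (hmom h (by norm_num) (by norm_num))
    exact ⟨C, n₀, hC, fun n hn hmem => (hu _ (fun T => Nat.cast_nonneg _) (hle 3) n hn hmem).1⟩
  · obtain ⟨C, hC, n₀, hu⟩ := exists_condExp_le_log hp (hmom h (by norm_num) (by norm_num))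
    exact ⟨C, n₀, hC, fun n hn hmem =>
      (hu _ (fun T => Nat.cast_nonneg _) (fun T => le_rfl) n hn hmem).1⟩
  · obtain ⟨C, hC, n₀, hu⟩ := exists_condExp_le_const hp (hmom h (by norm_num) (by norm_num))
    exact ⟨C, n₀, hC, hu _ (fun T => Nat.cast_nonneg _) (hle 4)⟩
  · obtain ⟨C, hC, n₀, hu⟩ := exists_condExp_le_const hp (hmom h (by norm_num) (by norm_num))
    exact ⟨C, n₀, hC, hu _ (fun T => Nat.cast_nonneg _) (fun T => le_rfl)⟩
  · obtain ⟨C, hC, n₀, hu⟩ := exists_condExp_le_log hp (hmom h (by norm_num) (by norm_num))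
    obtain ⟨c, hc, n₁, hl⟩ := exists_log_le_condExp_Nk_three hp hpos
    refine ⟨c, C, max n₀ n₁, hc, hC, fun n hn hmem => ?_⟩
    rw [max_le_iff] at hn
    have := hu _ (fun T => Nat.cast_nonneg _) (hle 3) n hn.1 hmem
    exact ⟨hl n hn.2 hmem this.2, this.1⟩
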